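/- arXiv:2005.05967 — 2 statements merged into one kernel-verified Lean document; each statement's English description precedes it below -/
import Mathlib

section
/- Assume X_N is an N-dimensional subspace of L_∞(Ω) (Ω a compact subset of ℝ^d with probability measure μ) satisfying: (i) there is a constant K1 > 1 with ‖f‖_∞ ≤ (K1·N)^{1/2}·‖f‖_2 for all f ∈ X_N, and (ii) there is a constant K2 > 1 with ‖f‖_∞ ≤ K2·‖f‖_{log N} for all f ∈ X_N. Then for each 1 ≤ q ≤ 2 there is a constant C(q) > 0 depending only on q such that the entropy numbers of X_N^q := {f ∈ X_N : ‖f‖_q ≤ 1} in the uniform norm satisfy ε_k(X_N^q, L_∞) ≤ C(q)·(K1·K2^2·log N)^{1/q}·(N/k)^{1/q} for 1 ≤ k ≤ N, and ε_k(X_N^q, L_∞) ≤ C(q)·(K1·K2^2·log N)^{1/q}·2^{−k/N} for k > N. -/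
noncomputable section
open MeasureTheory

/-- The `L_q(Ω,μ)` norm of a real-valued function. -/
def lqNorm {d : ℕ} (μ : Measure (Fin d → ℝ)) (Ω : Set (Fin d → ℝ)) (q : ℝ)
    (f : (Fin d → ℝ) → ℝ) : ℝ := (∫ x in Ω, |f x| ^ q ∂μ) ^ (1 / q)

/-- The uniform norm on `Ω` of a real-valued function. -/
def supNorm {d : ℕ} (Ω : Set (Fin d → ℝ)) (f : (Fin d → ℝ) → ℝ) : ℝ := ⨆ x : Ω, |f x.1|

/-- The entropy numbers `ε_k(A, p)` of a set `A` with respect to a (semi)norm `p`: the infimum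
of `ε > 0` such that `A` can be covered by `2^k` `p`-balls of radius `ε` centered in `A`. -/
def entNum {E : Type*} [Sub E] (A : Set E) (p : E → ℝ) (k : ℕ) : ℝ :=
  sInf {ε : ℝ | 0 < ε ∧ ∃ y : Fin (2 ^ k) → E, (∀ j, y j ∈ A) ∧ ∀ x ∈ A, ∃ j, p (x - y j) ≤ ε}


def gd {ι : Type*} [Fintype ι] (x : ι → ℝ) : ℝ := ∏ i, ProbabilityTheory.gaussianPDFReal 0 1 (x i)

lemma gd_nonneg {ι : Type*} [Fintype ι] (x : ι → ℝ) : 0 ≤ gd x :=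
  Finset.prod_nonneg fun i _ => ProbabilityTheory.gaussianPDFReal_nonneg 0 1 (x i)

lemma gd_meas {ι : Type*} [Fintype ι] : Measurable (gd : (ι → ℝ) → ℝ) := by
  unfold gd
  refine Finset.measurable_prod _ fun i _ => ?_
  exact (ProbabilityTheory.measurable_gaussianPDFReal 0 1).comp (measurable_pi_apply i)

lemma gd_lintegral {ι : Type*} [Fintype ι] : ∫⁻ x : ι → ℝ, ENNReal.ofReal (gd x) = 1 := by
  rw [← ofReal_integral_eq_lintegral_ofReal]
  · unfold gd
    rw [integral_fintype_prod_volume_eq_prod (fun (_ : ι) y => ProbabilityTheory.gaussianPDFReal 0 1 y)]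
    simp [ProbabilityTheory.integral_gaussianPDFReal_eq_one]
  · unfold gd
    exact Integrable.fintype_prod (f := fun (_ : ι) y => ProbabilityTheory.gaussianPDFReal 0 1 y) (μ := fun _ => volume)
      (fun i => ProbabilityTheory.integrable_gaussianPDFReal 0 1)
  · exact Filter.Eventually.of_forall gd_nonneg

lemma gd_shift {ι : Type*} [Fintype ι] (x z : ι → ℝ) :
    gd (x + z) = gd x * Real.exp (-(∑ i, z i * x i)) * Real.exp (-(∑ i, z i ^ 2) / 2) := by
  unfold gd
  have : ∀ i, ProbabilityTheory.gaussianPDFReal 0 1 ((x + z) i) =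
      ProbabilityTheory.gaussianPDFReal 0 1 (x i) * Real.exp (-(z i * x i)) * Real.exp (-(z i ^2) / 2) := by
    intro i
    simp only [ProbabilityTheory.gaussianPDFReal, mul_assoc, ← Real.exp_add]
    congr 3
    simp
    ring
  simp_rw [this, Finset.prod_mul_distrib, ← Real.exp_sum]
  simp [Finset.sum_div, neg_div]

def gm (ι : Type*) [Fintype ι] : Measure (ι → ℝ) := volume.withDensity (fun x => ENNReal.ofReal (gd x))

lemma gm_univ (ι : Type*) [Fintype ι] : gm ι Set.univ = 1 := by
  simp [gm, gd_lintegral]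

instance (ι : Type*) [Fintype ι] : IsProbabilityMeasure (gm ι) := ⟨gm_univ ι⟩

lemma gm_lint {ι : Type*} [Fintype ι] (f : (ι → ℝ) → ENNReal) (hf : Measurable f) :
    ∫⁻ x, f x ∂(gm ι) = ∫⁻ x, ENNReal.ofReal (gd x) * f x := by
  unfold gm
  rw [lintegral_withDensity_eq_lintegral_mul _ gd_meas.ennreal_ofReal hf]
  rfl

lemma gm_exp {ι : Type*} [Fintype ι] (s : ι → ℝ) :
    ∫⁻ x, ENNReal.ofReal (Real.exp (∑ i, s i * x i)) ∂(gm ι) = ENNReal.ofReal (Real.exp ((∑ i, s i ^ 2) / 2)) := by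
  rw [gm_lint _ (by fun_prop)]
  have : ∀ x : ι → ℝ, ENNReal.ofReal (gd x) * ENNReal.ofReal (Real.exp (∑ i, s i * x i)) =
     ENNReal.ofReal (Real.exp ((∑ i, s i ^ 2) / 2)) * ENNReal.ofReal (gd (x + (-s))) := by
    intro x
    rw [← ENNReal.ofReal_mul (gd_nonneg _), ← ENNReal.ofReal_mul (by positivity), gd_shift]
    congr 1
    have : Real.exp ((∑ i, s i ^ 2) / 2) * Real.exp (-(∑ i, (-s) i ^ 2) / 2) = 1 := by
      rw [← Real.exp_add, Real.exp_eq_one_iff]; simp; ring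
    have h2 : -(∑ i, (-s) i * x i) = ∑ i, s i * x i := by simp
    rw [h2]
    linear_combination (- gd x * Real.exp (∑ i, s i * x i)) * this
  simp_rw [this]
  rw [lintegral_const_mul _ (by have := gd_meas (ι := ι); fun_prop),
    lintegral_add_right_eq_self (fun x => ENNReal.ofReal (gd x)) (-s), gd_lintegral, mul_one]

lemma gm_shift {ι : Type*} [Fintype ι] (S : Set (ι → ℝ)) (hS : MeasurableSet S) (hsym : ∀ x ∈ S, -x ∈ S)
    (z : ι → ℝ) :
    ENNReal.ofReal (Real.exp (-(∑ i, z i ^ 2) / 2)) * gm ι S ≤ gm ι ((fun x => x - z) ⁻¹' S) := by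
  have hgd := gd_meas (ι := ι)
  have e1 : gm ι ((fun x => x - z) ⁻¹' S) = ∫⁻ x, ENNReal.ofReal (gd (x + z)) * S.indicator 1 x := by
    rw [← lintegral_indicator_one (hS.preimage (by fun_prop)), gm_lint]
    · rw [← lintegral_add_right_eq_self _ z]
      congr 1; ext x
      congr 1
      by_cases h : x ∈ S <;> simp [Set.indicator, Set.mem_preimage, h]
    · exact measurable_one.indicator (hS.preimage (by fun_prop))
  have hsym' : ∀ x, S.indicator (1 : (ι → ℝ) → ENNReal) (-x) = S.indicator 1 x := by
    intro x
    by_cases h : x ∈ S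
    · simp [h, hsym x h]
    · have : -x ∉ S := fun h' => h (by simpa using hsym _ h')
      simp [h, this]
  have hgsym : ∀ x : ι → ℝ, gd (-x) = gd x := by
    intro x; simp [gd, ProbabilityTheory.gaussianPDFReal]
  have e2 : gm ι ((fun x => x - z) ⁻¹' S) = ∫⁻ x, ENNReal.ofReal (gd (-x + z)) * S.indicator 1 x := by
    rw [e1, ← lintegral_neg_eq_self]
    simp_rw [hsym']
  have e3 : gm ι S = ∫⁻ x, ENNReal.ofReal (gd x) * S.indicator 1 x := by
    rw [← lintegral_indicator_one hS, gm_lint]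
    exact measurable_one.indicator hS
  have hI : Measurable (S.indicator (1 : (ι → ℝ) → ENNReal)) := measurable_one.indicator hS
  have key : 2 * (ENNReal.ofReal (Real.exp (-(∑ i, z i ^ 2) / 2)) * gm ι S) ≤
      gm ι ((fun x => x - z) ⁻¹' S) + gm ι ((fun x => x - z) ⁻¹' S) := by
    nth_rw 1 [e1]
    rw [e2, e3, ← lintegral_add_left (by fun_prop), ← mul_assoc, ← lintegral_const_mul _ (by fun_prop)]
    refine lintegral_mono fun x => ?_
    simp only
    rw [← add_mul, ← mul_assoc]
    gcongr
    rw [← ENNReal.ofReal_add (gd_nonneg _) (gd_nonneg _), show (2 : ENNReal) = ENNReal.ofReal 2 by simp,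
      ← ENNReal.ofReal_mul (by norm_num), ← ENNReal.ofReal_mul (by positivity)]
    apply ENNReal.ofReal_le_ofReal
    rw [gd_shift, gd_shift, hgsym]
    have h1 : -(∑ i, z i * (-x) i) = ∑ i, z i * x i := by simp
    rw [h1]
    set w := ∑ i, z i * x i
    have h2 : 2 ≤ Real.exp (-w) + Real.exp w := by
      have := Real.add_one_le_exp w
      have := Real.add_one_le_exp (-w)
      linarith
    have h3 : 0 ≤ gd x * Real.exp (-(∑ i, z i ^ 2) / 2) := mul_nonneg (gd_nonneg _) (by positivity)
    nlinarith [mul_le_mul_of_nonneg_left h2 h3]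
  rw [← two_mul] at key
  exact (ENNReal.mul_le_mul_iff_right (by norm_num) (by norm_num)).1 key
lemma gm_moment {ι : Type*} [Fintype ι] (a : ι → ℝ) (r σ : ℝ) (hr : 0 < r) (hσ : 0 < σ)
    (ha : ∑ i, a i ^ 2 ≤ σ ^ 2) :
    ∫⁻ x, ENNReal.ofReal (|∑ i, x i * a i| ^ r) ∂(gm ι) ≤ ENNReal.ofReal (2 * (Real.sqrt r * σ) ^ r) := by
  have hsr : 0 < Real.sqrt r := Real.sqrt_pos.2 hr
  set s := Real.sqrt r / σ with hs
  have hss : s ^ 2 * σ ^ 2 = r := by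
    rw [hs, div_pow, Real.sq_sqrt hr.le]; field_simp
  set D := (Real.sqrt r * σ) ^ r * Real.exp (-r) with hD
  have hD0 : 0 ≤ D := by positivity
  have pt : ∀ y : ℝ, |y| ^ r ≤ D * (Real.exp (s * y) + Real.exp (-(s * y))) := by
    intro y
    set w := |y| / (Real.sqrt r * σ) with hw
    have hw0 : 0 ≤ w := by positivity
    have e1 : |y| = (Real.sqrt r * σ) * w := by rw [hw]; field_simp
    have e2 : w ^ r ≤ Real.exp (-r) * Real.exp (s * |y|) := by
      have h1 : w ≤ Real.exp (w - 1) := by have := Real.add_one_le_exp (w - 1); linarith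
      calc w ^ r ≤ (Real.exp (w - 1)) ^ r := Real.rpow_le_rpow hw0 h1 hr.le
        _ = Real.exp (-r) * Real.exp (s * |y|) := by
          rw [← Real.exp_mul, ← Real.exp_add]
          congr 1
          rw [e1, hs]
          field_simp
          rw [Real.sq_sqrt hr.le]; ring
    have e3 : Real.exp (s * |y|) ≤ Real.exp (s * y) + Real.exp (-(s * y)) := by
      rcases abs_cases y with ⟨h, _⟩ | ⟨h, _⟩
      · rw [h]; have := Real.exp_pos (-(s * y)); linarith
      · rw [h, mul_neg]; have := Real.exp_pos ((s * y)); linarith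
    calc |y| ^ r = (Real.sqrt r * σ) ^ r * w ^ r := by
          rw [← Real.mul_rpow (by positivity) hw0, ← e1]
      _ ≤ (Real.sqrt r * σ) ^ r * (Real.exp (-r) * Real.exp (s * |y|)) := by gcongr
      _ ≤ (Real.sqrt r * σ) ^ r * (Real.exp (-r) * (Real.exp (s * y) + Real.exp (-(s * y)))) := by gcongr
      _ = _ := by rw [hD]; ring
  have bd : ∀ t : ℝ, t ^ 2 = s ^ 2 → ∫⁻ x, ENNReal.ofReal (Real.exp (∑ i, (t * a i) * x i)) ∂(gm ι) ≤
      ENNReal.ofReal (Real.exp (r / 2)) := by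
    intro t ht
    rw [gm_exp]
    apply ENNReal.ofReal_le_ofReal
    apply Real.exp_le_exp.2
    simp_rw [mul_pow]
    rw [← Finset.mul_sum, ht, ← hss]
    gcongr
  calc ∫⁻ x, ENNReal.ofReal (|∑ i, x i * a i| ^ r) ∂(gm ι)
      ≤ ∫⁻ x, ENNReal.ofReal D * (ENNReal.ofReal (Real.exp (∑ i, (s * a i) * x i)) +
          ENNReal.ofReal (Real.exp (∑ i, (-s * a i) * x i))) ∂(gm ι) := by
        refine lintegral_mono fun x => ?_
        simp only
        rw [← ENNReal.ofReal_add (by positivity) (by positivity), ← ENNReal.ofReal_mul hD0]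
        apply ENNReal.ofReal_le_ofReal
        have e1 : ∑ i, (s * a i) * x i = s * ∑ i, x i * a i := by
          rw [Finset.mul_sum]; exact Finset.sum_congr rfl fun i _ => by ring
        have e2 : ∑ i, (-s * a i) * x i = -(s * ∑ i, x i * a i) := by
          rw [← e1, ← Finset.sum_neg_distrib]; exact Finset.sum_congr rfl fun i _ => by ring
        rw [e1, e2]
        exact pt _
    _ ≤ ENNReal.ofReal D * (ENNReal.ofReal (Real.exp (r / 2)) + ENNReal.ofReal (Real.exp (r / 2))) := by
        rw [lintegral_const_mul _ (by fun_prop), lintegral_add_left (by fun_prop)]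
        gcongr
        · exact bd s rfl
        · exact bd (-s) (by ring)
    _ ≤ _ := by
        rw [← ENNReal.ofReal_add (by positivity) (by positivity), ← ENNReal.ofReal_mul hD0]
        apply ENNReal.ofReal_le_ofReal
        rw [hD]
        have : Real.exp (-r) * Real.exp (r / 2) ≤ 1 := by
          rw [← Real.exp_add]; apply Real.exp_le_one_iff.2; linarith
        have h3 : 0 ≤ (Real.sqrt r * σ) ^ r := by positivity
        nlinarith [mul_le_mul_of_nonneg_left this h3]

lemma gm_tail {ι α : Type*} [Fintype ι] [MeasurableSpace α] (ν : Measure α) [IsProbabilityMeasure ν]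
    (u : ι → α → ℝ) (hm : ∀ i j, AEMeasurable (fun x => u i x * u j x) ν)
    (r σ K l : ℝ) (hr : 0 < r) (hσ : 0 < σ) (hK : 0 < K) (hl : 0 < l)
    (hu : ∀ᵐ x ∂ν, ∑ i, u i x ^ 2 ≤ σ ^ 2)
    (p : (ι → ℝ) → ℝ) (hpm : Measurable p)
    (hp : ∀ a, ENNReal.ofReal (p a ^ r) ≤
      ENNReal.ofReal (K ^ r) * ∫⁻ x, ENNReal.ofReal (|∑ i, a i * u i x| ^ r) ∂ν)
    (hlK : 4 * (K * (Real.sqrt r * σ)) ^ r ≤ l ^ r) :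
    ENNReal.ofReal (1 / 2) ≤ gm ι {a | p a ≤ l} := by
  have hsr : 0 < Real.sqrt r := Real.sqrt_pos.2 hr
  have swap : ∫⁻ a, ∫⁻ x, ENNReal.ofReal (|∑ i, a i * u i x| ^ r) ∂ν ∂(gm ι) =
     ∫⁻ x, ∫⁻ a, ENNReal.ofReal (|∑ i, a i * u i x| ^ r) ∂(gm ι) ∂ν := by
    apply lintegral_lintegral_swap
    have e : (Function.uncurry fun (a : ι → ℝ) x => ENNReal.ofReal (|∑ i, a i * u i x| ^ r)) =
       fun z : (ι → ℝ) × α => ENNReal.ofReal ((∑ i, ∑ j, (z.1 i * z.1 j) * (u i z.2 * u j z.2)) ^ (r / 2)) := by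
      ext ⟨a, x⟩
      simp only [Function.uncurry]
      congr 1
      have : ∑ i, ∑ j, (a i * a j) * (u i x * u j x) = |∑ i, a i * u i x| ^ (2 : ℝ) := by
        rw [Real.rpow_two, sq_abs, sq, Finset.sum_mul_sum]
        exact Finset.sum_congr rfl fun i _ => Finset.sum_congr rfl fun j _ => by ring
      rw [this, ← Real.rpow_mul (abs_nonneg _)]
      congr 1; ring
    rw [e]
    have h2 : ∀ i j, AEMeasurable (fun z : (ι → ℝ) × α => u i z.2 * u j z.2) ((gm ι).prod ν) :=
      fun i j => (hm i j).comp_quasiMeasurePreserving Measure.quasiMeasurePreserving_snd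
    apply AEMeasurable.ennreal_ofReal
    apply AEMeasurable.pow_const
    refine Finset.aemeasurable_fun_sum _ fun i _ => Finset.aemeasurable_fun_sum _ fun j _ => ?_
    exact AEMeasurable.mul (by fun_prop) (h2 i j)
  have b1 : ∫⁻ a, ENNReal.ofReal (p a ^ r) ∂(gm ι) ≤ ENNReal.ofReal (2 * (K * (Real.sqrt r * σ)) ^ r) := by
    calc ∫⁻ a, ENNReal.ofReal (p a ^ r) ∂(gm ι) ≤
        ∫⁻ a, ENNReal.ofReal (K ^ r) * ∫⁻ x, ENNReal.ofReal (|∑ i, a i * u i x| ^ r) ∂ν ∂(gm ι) :=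
          lintegral_mono hp
      _ = ENNReal.ofReal (K ^ r) * ∫⁻ x, ∫⁻ a, ENNReal.ofReal (|∑ i, a i * u i x| ^ r) ∂(gm ι) ∂ν := by
          rw [lintegral_const_mul' _ _ (by simp), swap]
      _ ≤ ENNReal.ofReal (K ^ r) * ∫⁻ x, ENNReal.ofReal (2 * (Real.sqrt r * σ) ^ r) ∂ν := by
          refine mul_le_mul_right ?_ _
          apply lintegral_mono_ae
          filter_upwards [hu] with x hx
          exact gm_moment (fun i => u i x) r σ hr hσ hx
      _ = _ := by
          rw [lintegral_const, measure_univ, mul_one, ← ENNReal.ofReal_mul (by positivity),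
            Real.mul_rpow (x := K) (by positivity) (by positivity)]
          congr 1; ring
  have hpr : Measurable fun a => ENNReal.ofReal (p a ^ r) := by fun_prop
  have mk := mul_meas_ge_le_lintegral (μ := gm ι) hpr (ENNReal.ofReal (l ^ r))
  have sub : {a | p a ≤ l}ᶜ ⊆ {a | ENNReal.ofReal (l ^ r) ≤ ENNReal.ofReal (p a ^ r)} := by
    intro a ha
    simp only [Set.mem_compl_iff, Set.mem_ofPred_eq, not_le] at ha ⊢
    exact ENNReal.ofReal_le_ofReal (Real.rpow_le_rpow hl.le ha.le hr.le)
  have hlr : 0 < l ^ r := by positivity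
  have b2 : ENNReal.ofReal (l ^ r) * gm ι {a | p a ≤ l}ᶜ ≤ ENNReal.ofReal (l ^ r) * ENNReal.ofReal (1 / 2) := by
    calc _ ≤ _ := mul_le_mul_right (measure_mono sub) _
      _ ≤ _ := mk
      _ ≤ _ := b1
      _ ≤ _ := by
        rw [← ENNReal.ofReal_mul hlr.le]
        apply ENNReal.ofReal_le_ofReal
        linarith
  have b3 : gm ι {a | p a ≤ l}ᶜ ≤ ENNReal.ofReal (1 / 2) :=
    (ENNReal.mul_le_mul_iff_right (by simpa using hlr) (by simp)).1 b2
  have hms : MeasurableSet {a | p a ≤ l} := measurableSet_le hpm measurable_const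
  have b4 := prob_add_prob_compl (μ := gm ι) hms
  have b5 : (1 : ENNReal) = ENNReal.ofReal (1/2) + ENNReal.ofReal (1/2) := by
    rw [← ENNReal.ofReal_add] <;> norm_num
  have b6 : ENNReal.ofReal (1/2) + ENNReal.ofReal (1/2) ≤ gm ι {a | p a ≤ l} + ENNReal.ofReal (1/2) := by
    rw [← b5, ← b4]; gcongr
  exact (ENNReal.add_le_add_iff_right (by simp)).1 b6

lemma dual_sudakov {ι κ : Type*} [Fintype ι] (p : (ι → ℝ) → ℝ) (hpm : Measurable p)
    (hsub : ∀ a b, p (a + b) ≤ p a + p b) (hneg : ∀ a, p (-a) = p a)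
    (hsmul : ∀ (c : ℝ) a, 0 < c → p (c • a) = c * p a)
    (l ε R : ℝ) (hl : 0 < l) (hε : 0 < ε)
    (hγ : ENNReal.ofReal (1 / 2) ≤ gm ι {a | p a ≤ l})
    (T : Finset κ) (x : κ → ι → ℝ) (hx : ∀ j ∈ T, ∑ i, x j i ^ 2 ≤ R)
    (hsep : ∀ i ∈ T, ∀ j ∈ T, i ≠ j → ε < p (x i - x j)) :
    (T.card : ℝ) ≤ 2 * Real.exp (2 * l ^ 2 * R / ε ^ 2) := by
  set t := 2 * l / ε with ht
  have ht0 : 0 < t := by positivity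
  set S : Set (ι → ℝ) := {a | p a ≤ l} with hS
  have hSm : MeasurableSet S := measurableSet_le hpm measurable_const
  let F : κ → Set (ι → ℝ) := fun j => (fun y => y - t • x j) ⁻¹' S
  have hFm : ∀ j, MeasurableSet (F j) := fun j => hSm.preimage (by fun_prop)
  have hdisj : Set.PairwiseDisjoint (T : Set κ) F := by
    intro i hi j hj hij
    apply Set.disjoint_left.2
    intro y hy1 hy2
    have h1 : p (y - t • x i) ≤ l := hy1
    have h2 : p (y - t • x j) ≤ l := hy2
    have h3 := hsub (-(y - t • x i)) (y - t • x j)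
    rw [hneg] at h3
    have e : -(y - t • x i) + (y - t • x j) = t • (x i - x j) := by
      rw [smul_sub]; abel
    rw [e, hsmul _ _ ht0] at h3
    have h4 := mul_lt_mul_of_pos_left (hsep i hi j hj hij) ht0
    have h5 : t * ε = 2 * l := by rw [ht]; field_simp
    linarith
  set δ := Real.exp (-(2 * l ^ 2 * R / ε ^ 2)) / 2 with hδ
  have hlow : ∀ j ∈ T, ENNReal.ofReal δ ≤ gm ι (F j) := by
    intro j hj
    refine le_trans ?_ (gm_shift S hSm (fun a ha => by simpa [hS, hneg] using ha) (t • x j))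
    calc ENNReal.ofReal δ = ENNReal.ofReal (Real.exp (-(2 * l ^ 2 * R / ε ^ 2))) * ENNReal.ofReal (1 / 2) := by
          rw [← ENNReal.ofReal_mul (by positivity), hδ]; congr 1; ring
      _ ≤ _ := by
          gcongr
          have : ∑ i, (t • x j) i ^ 2 = t ^ 2 * ∑ i, x j i ^ 2 := by
            simp [Finset.mul_sum, mul_pow]
          rw [this, ht]
          have h6 : (2 * l / ε) ^ 2 * ∑ i, x j i ^ 2 ≤ (2 * l / ε) ^ 2 * R := by
            gcongr; exact hx j hj
          have h7 : (2 * l / ε) ^ 2 * R / 2 = 2 * l ^ 2 * R / ε ^ 2 := by field_simp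
          linarith
  have hsum : ∑ j ∈ T, gm ι (F j) ≤ 1 := by
    rw [← measure_biUnion_finset hdisj (fun j _ => hFm j)]
    exact prob_le_one
  have hsum2 : (T.card : ENNReal) * ENNReal.ofReal δ ≤ 1 := by
    refine le_trans ?_ hsum
    rw [← nsmul_eq_mul, ← Finset.sum_const]
    exact Finset.sum_le_sum hlow
  have hδ0 : 0 < δ := by positivity
  have hsum3 : (T.card : ℝ) * δ ≤ 1 := by
    have e : (T.card : ENNReal) = ENNReal.ofReal (T.card : ℝ) := by simp
    rw [e, ← ENNReal.ofReal_mul (by positivity)] at hsum2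
    exact ENNReal.ofReal_le_one.1 hsum2
  rw [hδ, Real.exp_neg] at hsum3
  have hE := Real.exp_pos (2 * l ^ 2 * R / ε ^ 2)
  field_simp at hsum3
  linarith

open scoped Pointwise in
lemma vol_pack {ι κ : Type*} [Fintype ι] (p : (ι → ℝ) → ℝ) (hpc : Continuous p)
    (hsub : ∀ a b, p (a + b) ≤ p a + p b) (hneg : ∀ a, p (-a) = p a)
    (hsmul : ∀ (c : ℝ) a, 0 < c → p (c • a) = c * p a)
    (hlow : ∀ a i, |a i| ≤ p a) (h0 : p 0 = 0)
    (ε R : ℝ) (hR : 0 < R) (hε : 0 < ε)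
    (T : Finset κ) (x : κ → ι → ℝ) (hx : ∀ j ∈ T, p (x j) ≤ R)
    (hsep : ∀ i ∈ T, ∀ j ∈ T, i ≠ j → ε < p (x i - x j)) :
    (T.card : ℝ) ≤ (1 + 2 * R / ε) ^ (Fintype.card ι) := by
  set S : Set (ι → ℝ) := {a | p a < 1} with hS
  have hSo : IsOpen S := isOpen_lt hpc continuous_const
  have hvpos : 0 < volume S := hSo.measure_pos _ ⟨0, by simp [hS, h0]⟩
  have hvfin : volume S ≠ ⊤ := by
    have : S ⊆ Metric.closedBall 0 1 := by
      intro a ha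
      rw [mem_closedBall_zero_iff, pi_norm_le_iff_of_nonneg zero_le_one]
      intro i
      exact (hlow a i).trans (le_of_lt ha)
    exact ne_top_of_le_ne_top (isCompact_closedBall (0 : ι → ℝ) 1).measure_ne_top (measure_mono this)
  have hsc : ∀ c : ℝ, 0 < c → volume {a | p a < c} = ENNReal.ofReal (c ^ Fintype.card ι) * volume S := by
    intro c hc
    have : {a | p a < c} = c • S := by
      ext a
      rw [Set.mem_smul_set_iff_inv_smul_mem₀ hc.ne']
      simp only [hS, Set.mem_ofPred_eq]
      rw [hsmul _ _ (inv_pos.2 hc), inv_mul_lt_one₀ hc]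
    rw [this, Measure.addHaar_smul]
    simp [abs_of_pos hc]
  let F : κ → Set (ι → ℝ) := fun j => (fun y => y - x j) ⁻¹' {a | p a < ε / 2}
  have hFm : ∀ j, MeasurableSet (F j) := fun j =>
    ((isOpen_lt hpc continuous_const).measurableSet).preimage (by fun_prop)
  have hFv : ∀ j, volume (F j) = ENNReal.ofReal ((ε / 2) ^ Fintype.card ι) * volume S := by
    intro j
    rw [← hsc _ (by positivity)]
    simp only [F, sub_eq_add_neg]
    exact measure_preimage_add_right _ _ _
  have hdisj : Set.PairwiseDisjoint (T : Set κ) F := by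
    intro i hi j hj hij
    apply Set.disjoint_left.2
    intro y hy1 hy2
    have h1 : p (y - x i) < ε / 2 := hy1
    have h2 : p (y - x j) < ε / 2 := hy2
    have h3 := hsub (-(y - x i)) (y - x j)
    rw [hneg] at h3
    have e : -(y - x i) + (y - x j) = (x i - x j) := by abel
    rw [e] at h3
    have := hsep i hi j hj hij
    linarith
  have hsum : ∑ j ∈ T, volume (F j) ≤ volume {a | p a < R + ε / 2} := by
    rw [← measure_biUnion_finset hdisj (fun j _ => hFm j)]
    apply measure_mono
    intro y hy
    simp only [Set.mem_iUnion] at hy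
    obtain ⟨j, hj, hy⟩ := hy
    have h2 : p (y - x j) < ε / 2 := hy
    have h3 := hsub (y - x j) (x j)
    rw [sub_add_cancel] at h3
    have := hx j hj
    show p y < R + ε / 2
    linarith
  rw [hsc _ (by positivity)] at hsum
  simp_rw [hFv] at hsum
  rw [Finset.sum_const, nsmul_eq_mul, ← mul_assoc, ENNReal.mul_le_mul_iff_left hvpos.ne' hvfin] at hsum
  have e : (T.card : ENNReal) = ENNReal.ofReal (T.card : ℝ) := by simp
  rw [e, ← ENNReal.ofReal_mul (by positivity), ENNReal.ofReal_le_ofReal_iff (by positivity)] at hsum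
  have e2 : 1 + 2 * R / ε = (R + ε / 2) / (ε / 2) := by field_simp; ring
  rw [e2, div_pow, le_div_iff₀ (by positivity)]
  exact hsum

/-! ### Packing and entropy numbers -/

section packing
variable {d : ℕ} {Ω : Set (Fin d → ℝ)}

lemma supNorm_symm (f g : (Fin d → ℝ) → ℝ) : supNorm Ω (f - g) = supNorm Ω (g - f) := by
  unfold supNorm
  simp only [Pi.sub_apply, abs_sub_comm]

lemma supNorm_nonneg (f : (Fin d → ℝ) → ℝ) : 0 ≤ supNorm Ω f :=
  Real.iSup_nonneg fun _ => abs_nonneg _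

lemma supNorm_zero : supNorm Ω (0 : (Fin d → ℝ) → ℝ) = 0 := by
  unfold supNorm; simp

/-- Every `ε`-separated finite subset of `A` has at most `M` elements. -/
def Pk (Ω : Set (Fin d → ℝ)) (A : Set ((Fin d → ℝ) → ℝ)) (ε : ℝ) (M : ℕ) : Prop :=
  ∀ T : Finset ((Fin d → ℝ) → ℝ), (∀ f ∈ T, f ∈ A) →
    (∀ f ∈ T, ∀ g ∈ T, f ≠ g → ε < supNorm Ω (f - g)) → T.card ≤ M

lemma Pk.mono {A : Set ((Fin d → ℝ) → ℝ)} {ε ε' : ℝ} {M M' : ℕ} (h : Pk Ω A ε M) (hε : ε ≤ ε')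
    (hM : M ≤ M') : Pk Ω A ε' M' := fun T h1 h2 =>
  (h T h1 fun f hf g hg hfg => hε.trans_lt (h2 f hf g hg hfg)).trans hM

lemma Pk_one {A : Set ((Fin d → ℝ) → ℝ)} {ε : ℝ} (h : ∀ f ∈ A, ∀ g ∈ A, supNorm Ω (f - g) ≤ ε) :
    Pk Ω A ε 1 := by
  intro T h1 h2
  rw [Finset.card_le_one]
  intro f hf g hg
  by_contra hfg
  exact absurd (h2 f hf g hg hfg) (not_lt.2 (h f (h1 f hf) g (h1 g hg)))

lemma Pk.cover {A : Set ((Fin d → ℝ) → ℝ)} {ε : ℝ} {M : ℕ} (hε : 0 ≤ ε) (h : Pk Ω A ε M) :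
    ∃ T : Finset ((Fin d → ℝ) → ℝ), (∀ f ∈ T, f ∈ A) ∧ T.card ≤ M ∧
      ∀ x ∈ A, ∃ y ∈ T, supNorm Ω (x - y) ≤ ε := by
  classical
  let P : ℕ → Prop := fun n => ∃ T : Finset ((Fin d → ℝ) → ℝ), (∀ f ∈ T, f ∈ A) ∧
    (∀ f ∈ T, ∀ g ∈ T, f ≠ g → ε < supNorm Ω (f - g)) ∧ T.card = n
  have h0 : P 0 := ⟨∅, by simp, by simp, by simp⟩
  have hM : ¬ P (M + 1) := by
    rintro ⟨T, h1, h2, h3⟩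
    have := h T h1 h2
    omega
  obtain ⟨n, hn, hn'⟩ : ∃ n, P n ∧ ¬ P (n + 1) := by
    by_contra hcon
    push Not at hcon
    have : ∀ n, P n := fun n => by
      induction n with
      | zero => exact h0
      | succ k ih => exact hcon k ih
    exact hM (this _)
  obtain ⟨T, h1, h2, h3⟩ := hn
  refine ⟨T, h1, h T h1 h2, ?_⟩
  intro x hx
  by_contra hcon
  push Not at hcon
  apply hn'
  have hxT : x ∉ T := by
    intro hxT
    have := hcon x hxT
    rw [sub_self, supNorm_zero] at this
    linarith
  refine ⟨insert x T, ?_, ?_, by rw [Finset.card_insert_of_notMem hxT, h3]⟩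
  · intro f hf
    rcases Finset.mem_insert.1 hf with rfl | hf
    · exact hx
    · exact h1 f hf
  · intro f hf g hg hfg
    rcases Finset.mem_insert.1 hf with hf' | hf' <;> rcases Finset.mem_insert.1 hg with hg' | hg'
    · exact absurd (hf'.trans hg'.symm) hfg
    · rw [hf']; exact hcon g hg'
    · rw [supNorm_symm, hg']; exact hcon f hf'
    · exact h2 f hf' g hg' hfg

lemma Pk.combine {A : Set ((Fin d → ℝ) → ℝ)} {ε ε' : ℝ} {M M' : ℕ} (hε : 0 ≤ ε) (h : Pk Ω A ε M)
    (h' : ∀ f₀ ∈ A, Pk Ω {f | f ∈ A ∧ supNorm Ω (f - f₀) ≤ ε} ε' M') : Pk Ω A ε' (M * M') := by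
  classical
  obtain ⟨T₀, h1, h2, h3⟩ := h.cover hε
  intro T hT hsep
  have hsub : T ⊆ T₀.biUnion fun y => T.filter fun f => supNorm Ω (f - y) ≤ ε := by
    intro f hf
    obtain ⟨y, hy, hfy⟩ := h3 f (hT f hf)
    exact Finset.mem_biUnion.2 ⟨y, hy, Finset.mem_filter.2 ⟨hf, hfy⟩⟩
  refine (Finset.card_le_card hsub).trans ((Finset.card_biUnion_le_card_mul _ _ M' ?_).trans
    (Nat.mul_le_mul_right _ h2))
  intro y hy
  refine h' y (h1 y hy) _ ?_ ?_
  · intro f hf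
    have := Finset.mem_filter.1 hf
    exact ⟨hT f this.1, this.2⟩
  · intro f hf g hg
    exact hsep f (Finset.mem_filter.1 hf).1 g (Finset.mem_filter.1 hg).1

lemma entNum_le_of_cover {A : Set ((Fin d → ℝ) → ℝ)} {ε : ℝ} {k : ℕ} (hε : 0 < ε)
    (h0 : (0 : (Fin d → ℝ) → ℝ) ∈ A)
    (T : Finset ((Fin d → ℝ) → ℝ)) (h1 : ∀ f ∈ T, f ∈ A) (h2 : T.card ≤ 2 ^ k)
    (h3 : ∀ x ∈ A, ∃ y ∈ T, supNorm Ω (x - y) ≤ ε) : entNum A (supNorm Ω) k ≤ ε := by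
  apply csInf_le ⟨0, fun x hx => hx.1.le⟩
  refine ⟨hε, ?_⟩
  let e := T.equivFin
  refine ⟨fun j => if hj : (j : ℕ) < T.card then (e.symm ⟨j, hj⟩).1 else 0, ?_, ?_⟩
  · intro j
    by_cases hj : (j : ℕ) < T.card
    · simp only [hj, dite_true]; exact h1 _ (e.symm ⟨j, hj⟩).2
    · simp only [hj, dite_false]; exact h0
  · intro x hx
    obtain ⟨y, hy, hxy⟩ := h3 x hx
    refine ⟨⟨e ⟨y, hy⟩, (e ⟨y, hy⟩).2.trans_le h2⟩, ?_⟩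
    simpa using hxy

lemma Pk.entNum_le {A : Set ((Fin d → ℝ) → ℝ)} {ε : ℝ} {k : ℕ} (hε : 0 < ε)
    (h0 : (0 : (Fin d → ℝ) → ℝ) ∈ A) (h : Pk Ω A ε (2 ^ k)) : entNum A (supNorm Ω) k ≤ ε := by
  obtain ⟨T, h1, h2, h3⟩ := h.cover hε.le
  exact entNum_le_of_cover hε h0 T h1 h2 h3

end packing

/-! ### The nondegenerate case -/

structure Good {d : ℕ} (N : ℕ) (Ω : Set (Fin d → ℝ)) (μ : Measure (Fin d → ℝ))
    (X : Submodule ℝ ((Fin d → ℝ) → ℝ)) (K1 K2 : ℝ) : Prop where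
  hN : 2 ≤ N
  hΩ : IsCompact Ω
  hμ : IsProbabilityMeasure μ
  hc : μ Ωᶜ = 0
  hX : Module.finrank ℝ X = N
  hK1 : 1 < K1
  hK2 : 1 < K2
  h1 : ∀ f ∈ X, supNorm Ω f ≤ (K1 * N) ^ ((1 : ℝ) / 2) * lqNorm μ Ω 2 f
  h2 : ∀ f ∈ X, supNorm Ω f ≤ K2 * lqNorm μ Ω (Real.log N) f
  hb : ∀ f ∈ X, BddAbove (Set.range fun x : Ω => |f x.1|)

namespace Good
variable {d N : ℕ} {Ω : Set (Fin d → ℝ)} {μ : Measure (Fin d → ℝ)}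
    {X : Submodule ℝ ((Fin d → ℝ) → ℝ)} {K1 K2 : ℝ}

lemma prob (G : Good N Ω μ X K1 K2) : IsProbabilityMeasure (μ.restrict Ω) := by
  have := G.hμ
  constructor
  rw [Measure.restrict_apply_univ]
  exact (prob_compl_eq_zero_iff G.hΩ.measurableSet).1 G.hc

lemma ne (G : Good N Ω μ X K1 K2) : Nonempty Ω := by
  have := G.prob
  by_contra h
  rw [not_nonempty_iff, Set.isEmpty_coe_sort] at h
  have h1 : (μ.restrict Ω) Set.univ = 1 := measure_univ
  simp [h] at h1

lemma le_sup (G : Good N Ω μ X K1 K2) {f : (Fin d → ℝ) → ℝ} (hf : f ∈ X) {x : Fin d → ℝ} (hx : x ∈ Ω) :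
    |f x| ≤ supNorm Ω f := le_ciSup (G.hb f hf) ⟨x, hx⟩

lemma sup_le (G : Good N Ω μ X K1 K2) {f : (Fin d → ℝ) → ℝ} {c : ℝ} (h : ∀ x ∈ Ω, |f x| ≤ c) :
    supNorm Ω f ≤ c := by
  have := G.ne
  exact ciSup_le fun x => h x.1 x.2

lemma sq_int (G : Good N Ω μ X K1 K2) {f : (Fin d → ℝ) → ℝ} (hf : f ∈ X) :
    Integrable (fun x => f x ^ 2) (μ.restrict Ω) := by
  by_contra h
  have e : lqNorm μ Ω 2 f = 0 := by
    unfold lqNorm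
    have : (fun x => |f x| ^ (2 : ℝ)) = fun x => f x ^ 2 := by ext x; simp
    rw [this, integral_undef h]; simp
  have h1 := G.h1 f hf
  rw [e, mul_zero] at h1
  apply h
  have : (fun x => f x ^ 2) =ᵐ[μ.restrict Ω] fun _ => 0 := by
    filter_upwards [ae_restrict_mem G.hΩ.measurableSet] with x hx
    have := (G.le_sup hf hx).trans h1
    simpa using this
  exact (integrable_zero _ _ _).congr this.symm

lemma mul_int (G : Good N Ω μ X K1 K2) {f g : (Fin d → ℝ) → ℝ} (hf : f ∈ X) (hg : g ∈ X) :
    Integrable (fun x => f x * g x) (μ.restrict Ω) := by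
  have h1 := G.sq_int (X.add_mem hf hg)
  have h2 := G.sq_int (X.sub_mem hf hg)
  have h3 := (h1.sub h2).const_mul (1 / 4)
  refine h3.congr (Filter.Eventually.of_forall fun x => ?_)
  simp
  ring

lemma pow_int (G : Good N Ω μ X K1 K2) {f : (Fin d → ℝ) → ℝ} (hf : f ∈ X) {r : ℝ} (hr : 0 < r) :
    Integrable (fun x => |f x| ^ r) (μ.restrict Ω) := by
  have := G.prob
  have e : (fun x => |f x| ^ r) = fun x => (f x ^ 2) ^ (r / 2) := by
    ext x
    rw [← sq_abs, ← Real.rpow_natCast, ← Real.rpow_mul (abs_nonneg _)]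
    congr 1; push_cast; ring
  refine Integrable.of_bound (C := supNorm Ω f ^ r) ?_ ?_
  · rw [e]
    exact ((G.sq_int hf).aestronglyMeasurable.aemeasurable.pow_const _).aestronglyMeasurable
  · filter_upwards [ae_restrict_mem G.hΩ.measurableSet] with x hx
    rw [Real.norm_of_nonneg (by positivity)]
    exact Real.rpow_le_rpow (abs_nonneg _) (G.le_sup hf hx) hr.le

lemma l2_sq (f : (Fin d → ℝ) → ℝ) : lqNorm μ Ω 2 f = Real.sqrt (∫ x in Ω, f x ^ 2 ∂μ) := by
  unfold lqNorm
  have : (fun x => |f x| ^ (2 : ℝ)) = fun x => f x ^ 2 := by ext x; simp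
  rw [this, Real.sqrt_eq_rpow]

lemma sup_sq (G : Good N Ω μ X K1 K2) {f : (Fin d → ℝ) → ℝ} (hf : f ∈ X) :
    supNorm Ω f ^ 2 ≤ K1 * N * ∫ x in Ω, f x ^ 2 ∂μ := by
  have h := G.h1 f hf
  have hK := G.hK1
  rw [l2_sq, ← Real.sqrt_eq_rpow, ← Real.sqrt_mul (by positivity)] at h
  have h0 : 0 ≤ ∫ x in Ω, f x ^ 2 ∂μ := integral_nonneg fun x => sq_nonneg _
  have := pow_le_pow_left₀ (supNorm_nonneg f) h 2
  rwa [Real.sq_sqrt (by positivity)] at this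

lemma rep (G : Good N Ω μ X K1 K2) : ∃ (ι : Type) (_ : Fintype ι) (u : ι → (Fin d → ℝ) → ℝ),
    Fintype.card ι ≤ N ∧ (∀ i, u i ∈ X) ∧
    (∀ f ∈ X, ∃ a : ι → ℝ, ∀ x ∈ Ω, f x = ∑ i, a i * u i x) ∧
    (∀ a : ι → ℝ, ∫ x in Ω, (∑ i, a i * u i x) ^ 2 ∂μ = ∑ i, a i ^ 2) := by
  classical
  have hfd : FiniteDimensional ℝ X := by
    apply FiniteDimensional.of_finrank_pos
    rw [G.hX]; have := G.hN; omega
  let B : LinearMap.BilinForm ℝ X := LinearMap.mk₂ ℝ (fun f g : X => ∫ x in Ω, f.1 x * g.1 x ∂μ)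
    (by
      intro f f' g
      rw [← integral_add (G.mul_int f.2 g.2) (G.mul_int f'.2 g.2)]
      congr 1; ext x; simp; ring)
    (by
      intro c f g
      rw [smul_eq_mul, ← integral_const_mul]
      congr 1; ext x; simp; ring)
    (by
      intro f g g'
      rw [← integral_add (G.mul_int f.2 g.2) (G.mul_int f.2 g'.2)]
      congr 1; ext x; simp; ring)
    (by
      intro c f g
      rw [smul_eq_mul, ← integral_const_mul]
      congr 1; ext x; simp; ring)
  have hBdef : ∀ f g : X, B f g = ∫ x in Ω, f.1 x * g.1 x ∂μ := fun f g => rfl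
  have hsymm : LinearMap.IsSymm B := by
    refine ⟨fun f g => ?_⟩
    simp only [RingHom.id_apply, hBdef]
    congr 1; ext x; ring
  obtain ⟨v, hv⟩ := LinearMap.BilinForm.exists_orthogonal_basis hsymm
  have hpos : ∀ f : X, 0 ≤ B f f := fun f => by
    rw [hBdef]; exact integral_nonneg fun x => mul_self_nonneg _
  let ι := {i : Fin (Module.finrank ℝ X) // B (v i) (v i) ≠ 0}
  let w : ι → X := fun i => (Real.sqrt (B (v i) (v i)))⁻¹ • v i
  have hww : ∀ i j, B (w i) (w j) = if i = j then 1 else 0 := by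
    intro i j
    simp only [w, map_smul, LinearMap.smul_apply, smul_eq_mul]
    split_ifs with hij
    · subst hij
      have h1 := Real.mul_self_sqrt (hpos (v i))
      have h2 : Real.sqrt (B (v i) (v i)) ≠ 0 := by
        intro h; rw [h] at h1; exact i.2 (by linarith)
      nth_rw 3 [← h1]
      field_simp
    · have : B (v i) (v j) = 0 := hv (fun h => hij (Subtype.ext h))
      rw [this]; simp
  refine ⟨ι, inferInstance, fun i => (w i).1, ?_, fun i => (w i).2, ?_, ?_⟩
  · refine (Fintype.card_subtype_le _).trans ?_
    simp [G.hX]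
  · intro f hf
    let f' : X := ⟨f, hf⟩
    refine ⟨fun i => v.repr f' i * Real.sqrt (B (v i) (v i)), fun x hx => ?_⟩
    have e1 : f x = ∑ i, v.repr f' i * (v i).1 x := by
      calc f x = (∑ i, v.repr f' i • v i : X).1 x := by rw [v.sum_repr]
        _ = _ := by rw [Submodule.coe_sum, Finset.sum_apply]; rfl
    rw [e1]
    have e2 : ∀ i, B (v i) (v i) = 0 → (v i).1 x = 0 := by
      intro i hi
      have := G.sup_sq (v i).2
      rw [hBdef] at hi
      simp_rw [sq (((v i).1) _)] at this
      rw [hi, mul_zero] at this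
      have h3 : supNorm Ω (v i).1 = 0 := by nlinarith [supNorm_nonneg (Ω := Ω) (v i).1]
      have h4 := G.le_sup (v i).2 hx
      rw [h3] at h4
      simpa using h4
    have e3 : ∑ i, v.repr f' i * (v i).1 x =
        ∑ i ∈ Finset.univ.filter (fun i => B (v i) (v i) ≠ 0), v.repr f' i * (v i).1 x := by
      symm
      apply Finset.sum_subset (Finset.filter_subset _ _)
      intro i _ hi
      have : B (v i) (v i) = 0 := by simpa using hi
      rw [e2 i this, mul_zero]
    rw [e3, Finset.sum_subtype (p := fun i => B (v i) (v i) ≠ 0) _ (by simp)]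
    refine Finset.sum_congr rfl fun i _ => ?_
    have h1 := Real.mul_self_sqrt (hpos (v i))
    have h2 : Real.sqrt (B (v i) (v i)) ≠ 0 := by
      intro h; rw [h] at h1; exact i.2 (by linarith)
    simp only [w, Submodule.coe_smul, Pi.smul_apply, smul_eq_mul]
    field_simp
  · intro a
    have e1 : ∫ x in Ω, (∑ i, a i * (w i).1 x) ^ 2 ∂μ = B (∑ i, a i • w i) (∑ i, a i • w i) := by
      rw [hBdef]
      congr 1; ext x
      simp [sq]
    rw [e1]
    simp only [map_sum, map_smul, LinearMap.sum_apply, LinearMap.smul_apply, smul_eq_mul, hww]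
    refine Finset.sum_congr rfl fun i _ => ?_
    rw [sq, Finset.sum_eq_single i]
    · simp
    · intro j _ hj
      simp [hj]
    · simp

/-- Coordinates together with the induced norm. -/
lemma coords (G : Good N Ω μ X K1 K2) : ∃ (ι : Type) (_ : Fintype ι) (p : (ι → ℝ) → ℝ),
    Fintype.card ι ≤ N ∧ Continuous p ∧ (∀ a b, p (a + b) ≤ p a + p b) ∧ (∀ a, p (-a) = p a) ∧
    (∀ (c : ℝ) a, 0 < c → p (c • a) = c * p a) ∧ (∀ a i, |a i| ≤ p a) ∧ p 0 = 0 ∧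
    (ENNReal.ofReal (1 / 2) ≤
      gm ι {a | p a ≤ 8 * (K2 * (Real.sqrt (Real.log N) * Real.sqrt (K1 * N)))}) ∧
    ∃ c : X → ι → ℝ, (∀ f, ∑ i, c f i ^ 2 = ∫ x in Ω, f.1 x ^ 2 ∂μ) ∧ (∀ f, p (c f) = supNorm Ω f.1) ∧
      ∀ f g, p (c f - c g) = supNorm Ω (f.1 - g.1) := by
  classical
  obtain ⟨ι, hι, u, hcard, hu, hrep, hquad⟩ := G.rep
  have hprob := G.prob
  have hK1 := G.hK1
  have hK2 := G.hK2
  have hN := G.hN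
  have hN' : (2 : ℝ) ≤ N := by exact_mod_cast hN
  have hlog : Real.log 2 ≤ Real.log N := Real.log_le_log (by norm_num) hN'
  have hl2 := Real.log_two_gt_d9
  let F : (ι → ℝ) → (Fin d → ℝ) → ℝ := fun a => ∑ i, a i • u i
  have hFx : ∀ a x, F a x = ∑ i, a i * u i x := by intro a x; simp [F]
  have hFX : ∀ a, F a ∈ X := fun a => X.sum_mem fun i _ => X.smul_mem _ (hu i)
  have hF2 : ∀ a, ∫ x in Ω, F a x ^ 2 ∂μ = ∑ i, a i ^ 2 := by
    intro a; simp_rw [hFx]; exact hquad a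
  let p : (ι → ℝ) → ℝ := fun a => supNorm Ω (F a)
  have hsub : ∀ a b, p (a + b) ≤ p a + p b := by
    intro a b
    apply G.sup_le
    intro x hx
    have : F (a + b) x = F a x + F b x := by
      simp [hFx, add_mul, Finset.sum_add_distrib]
    rw [this]
    exact (abs_add_le _ _).trans (add_le_add (G.le_sup (hFX a) hx) (G.le_sup (hFX b) hx))
  have hneg : ∀ a, p (-a) = p a := by
    intro a
    have : F (-a) = - F a := by simp [F]
    simp [p, supNorm, this]
  have hsmul : ∀ (c : ℝ) a, 0 < c → p (c • a) = c * p a := by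
    intro c a hc
    have : F (c • a) = c • F a := by simp [F, Finset.smul_sum, mul_smul]
    simp only [p, supNorm, this, Pi.smul_apply, smul_eq_mul, abs_mul, abs_of_pos hc]
    rw [Real.mul_iSup_of_nonneg hc.le]
  have hp0 : p 0 = 0 := by
    have : F 0 = 0 := by simp [F]
    simp [p, this, supNorm_zero]
  have hpsq : ∀ a, p a ^ 2 ≤ K1 * N * ∑ i, a i ^ 2 := by
    intro a
    rw [← hF2]
    exact G.sup_sq (hFX a)
  have hlow2 : ∀ a, ∑ i, a i ^ 2 ≤ p a ^ 2 := by
    intro a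
    rw [← hF2]
    calc ∫ x in Ω, F a x ^ 2 ∂μ ≤ ∫ x in Ω, p a ^ 2 ∂μ := by
          apply integral_mono_ae (G.sq_int (hFX a)) (integrable_const _)
          filter_upwards [ae_restrict_mem G.hΩ.measurableSet] with x hx
          rw [← sq_abs]
          exact pow_le_pow_left₀ (abs_nonneg _) (G.le_sup (hFX a) hx) 2
      _ = p a ^ 2 := by simp
  have hlow : ∀ a i, |a i| ≤ p a := by
    intro a i
    apply abs_le_of_sq_le_sq (le_trans _ (hlow2 a)) (supNorm_nonneg _)
    exact Finset.single_le_sum (f := fun i => a i ^ 2) (fun i _ => sq_nonneg _) (Finset.mem_univ i)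
  have hcont : Continuous p := by
    rw [continuous_iff_continuousAt]
    intro a
    rw [ContinuousAt, tendsto_iff_dist_tendsto_zero]
    have hbd : ∀ b, dist (p b) (p a) ≤ Real.sqrt (K1 * N * ∑ i, (b i - a i) ^ 2) := by
      intro b
      have h1 := hsub (b - a) a
      have h2 := hsub (-(b - a)) b
      rw [hneg] at h2
      rw [sub_add_cancel] at h1
      rw [show -(b - a) + b = a by abel] at h2
      have h3 : p (b - a) ≤ Real.sqrt (K1 * N * ∑ i, (b i - a i) ^ 2) :=
        Real.le_sqrt_of_sq_le (hpsq (b - a))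
      rw [Real.dist_eq, abs_le]
      constructor <;> linarith
    refine squeeze_zero (fun b => dist_nonneg) hbd ?_
    have hc : Continuous fun b : ι → ℝ => Real.sqrt (K1 * N * ∑ i, (b i - a i) ^ 2) := by fun_prop
    have := hc.tendsto a
    simpa using this
  have hlogpos : 0 < Real.log N := by linarith
  have hKN : 0 < K1 * N := by positivity
  have hσ : ∀ x ∈ Ω, ∑ i, u i x ^ 2 ≤ Real.sqrt (K1 * N) ^ 2 := by
    intro x hx
    rw [Real.sq_sqrt hKN.le]
    set s := ∑ i, u i x ^ 2 with hs
    have hs0 : 0 ≤ s := Finset.sum_nonneg fun i _ => sq_nonneg _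
    have h1 := hpsq (fun i => u i x)
    have h2 := G.le_sup (hFX (fun i => u i x)) hx
    have h3 : F (fun i => u i x) x = s := by rw [hFx, hs]; simp [sq]
    rw [h3, abs_of_nonneg hs0] at h2
    have h4 : s ^ 2 ≤ K1 * N * s := (pow_le_pow_left₀ hs0 h2 2).trans h1
    by_contra hcon
    push Not at hcon
    nlinarith
  refine ⟨ι, hι, p, hcard, hcont, hsub, hneg, hsmul, hlow, hp0, ?_, ?_⟩
  · refine gm_tail (μ.restrict Ω) u (fun i j => (G.mul_int (hu i) (hu j)).aestronglyMeasurable.aemeasurable)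
      (Real.log N) (Real.sqrt (K1 * N)) K2 _ hlogpos (by positivity) (by positivity) (by positivity)
      ?_ p hcont.measurable ?_ ?_
    · filter_upwards [ae_restrict_mem G.hΩ.measurableSet] with x hx using hσ x hx
    · intro a
      have h := G.h2 (F a) (hFX a)
      have hI : Integrable (fun x => |F a x| ^ Real.log N) (μ.restrict Ω) := G.pow_int (hFX a) hlogpos
      have hnn : 0 ≤ ∫ x in Ω, |F a x| ^ Real.log N ∂μ := integral_nonneg fun x => by positivity
      have e : ∫⁻ x in Ω, ENNReal.ofReal (|∑ i, a i * u i x| ^ Real.log N) ∂μ =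
          ENNReal.ofReal (∫ x in Ω, |F a x| ^ Real.log N ∂μ) := by
        rw [ofReal_integral_eq_lintegral_ofReal hI (Filter.Eventually.of_forall fun x => by positivity)]
        simp_rw [hFx]
      rw [e, ← ENNReal.ofReal_mul (by positivity)]
      apply ENNReal.ofReal_le_ofReal
      have h' := Real.rpow_le_rpow (supNorm_nonneg _) h hlogpos.le
      refine h'.trans (le_of_eq ?_)
      rw [Real.mul_rpow (by positivity) (by unfold lqNorm; positivity), lqNorm, ← Real.rpow_mul hnn,
        one_div_mul_cancel hlogpos.ne', Real.rpow_one]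
    · rw [Real.mul_rpow (x := 8) (by norm_num) (by positivity)]
      gcongr
      calc (4 : ℝ) = 8 ^ ((2 : ℝ) / 3) := by
            rw [show (8 : ℝ) = 2 ^ (3 : ℝ) by norm_num, ← Real.rpow_mul (by norm_num)]; norm_num
        _ ≤ 8 ^ Real.log N := Real.rpow_le_rpow_of_exponent_le (by norm_num) (by linarith)
  · choose c hc using fun f : X => hrep f.1 f.2
    have hcF : ∀ f, ∀ x ∈ Ω, f.1 x = F (c f) x := fun f x hx => by rw [hFx]; exact hc f x hx
    have hpe : ∀ (g h : (Fin d → ℝ) → ℝ), (∀ x ∈ Ω, g x = h x) → supNorm Ω g = supNorm Ω h := by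
      intro g h hgh
      unfold supNorm
      congr 1; ext x
      rw [hgh x.1 x.2]
    refine ⟨c, ?_, ?_, ?_⟩
    · intro f
      rw [← hF2]
      apply setIntegral_congr_fun G.hΩ.measurableSet
      intro x hx
      simp only [hcF f x hx]
    · intro f
      exact (hpe _ _ (hcF f)).symm
    · intro f g
      apply hpe
      intro x hx
      have : F (c f - c g) = F (c f) - F (c g) := by
        simp [F, sub_smul, Finset.sum_sub_distrib]
      rw [this, Pi.sub_apply, Pi.sub_apply, hcF f x hx, hcF g x hx]

lemma pack_l2 (G : Good N Ω μ X K1 K2) {A : Set ((Fin d → ℝ) → ℝ)} (hA : ∀ f ∈ A, f ∈ X)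
    (f₀ : (Fin d → ℝ) → ℝ) (hf₀ : f₀ ∈ X) (R ε : ℝ) (hε : 0 < ε)
    (hR : ∀ f ∈ A, ∫ x in Ω, (f x - f₀ x) ^ 2 ∂μ ≤ R) (M : ℕ)
    (hM : 2 * Real.exp (128 * (K1 * K2 ^ 2 * Real.log N * N) * R / ε ^ 2) ≤ M) : Pk Ω A ε M := by
  obtain ⟨ι, hι, p, hcard, hcont, hsub, hneg, hsmul, hlow, hp0, hγ, c, hc1, hc2, hc3⟩ := G.coords
  intro T hT hsep
  have hK1 := G.hK1
  have hK2 := G.hK2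
  have hN' : (2 : ℝ) ≤ N := by exact_mod_cast G.hN
  have hlogpos : 0 < Real.log N := Real.log_pos (by linarith)
  have key := dual_sudakov p hcont.measurable hsub hneg hsmul
    (8 * (K2 * (Real.sqrt (Real.log N) * Real.sqrt (K1 * N)))) ε R (by positivity) hε hγ
    (T.attach) (fun f => c ⟨f.1 - f₀, X.sub_mem (hA _ (hT f.1 f.2)) hf₀⟩)
    (by
      intro f _
      rw [hc1]
      exact hR f.1 (hT f.1 f.2))
    (by
      intro f _ g _ hfg
      rw [hc3]
      simp only [sub_sub_sub_cancel_right]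
      exact hsep f.1 f.2 g.1 g.2 (fun h => hfg (Subtype.ext h)))
  rw [Finset.card_attach] at key
  have e : 2 * (8 * (K2 * (Real.sqrt (Real.log N) * Real.sqrt (K1 * N)))) ^ 2 =
      128 * (K1 * K2 ^ 2 * Real.log N * N) := by
    simp only [mul_pow]
    rw [Real.sq_sqrt hlogpos.le, Real.sq_sqrt (by positivity)]; ring
  rw [e] at key
  exact_mod_cast key.trans hM

lemma pack_vol (G : Good N Ω μ X K1 K2) {A : Set ((Fin d → ℝ) → ℝ)} (hA : ∀ f ∈ A, f ∈ X)
    (f₀ : (Fin d → ℝ) → ℝ) (hf₀ : f₀ ∈ X) (R ε : ℝ) (hR0 : 0 < R) (hε : 0 < ε)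
    (hR : ∀ f ∈ A, supNorm Ω (f - f₀) ≤ R) (M : ℕ)
    (hM : (1 + 2 * R / ε) ^ N ≤ M) : Pk Ω A ε M := by
  obtain ⟨ι, hι, p, hcard, hcont, hsub, hneg, hsmul, hlow, hp0, hγ, c, hc1, hc2, hc3⟩ := G.coords
  intro T hT hsep
  have key := vol_pack p hcont hsub hneg hsmul hlow hp0 ε R hR0 hε
    (T.attach) (fun f => c ⟨f.1 - f₀, X.sub_mem (hA _ (hT f.1 f.2)) hf₀⟩)
    (by
      intro f _
      rw [hc2]
      exact hR f.1 (hT f.1 f.2))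
    (by
      intro f _ g _ hfg
      rw [hc3]
      simp only [sub_sub_sub_cancel_right]
      exact hsep f.1 f.2 g.1 g.2 (fun h => hfg (Subtype.ext h)))
  rw [Finset.card_attach] at key
  have h1 : (1 + 2 * R / ε) ^ Fintype.card ι ≤ (1 + 2 * R / ε) ^ N :=
    pow_le_pow_right₀ (by have : 0 ≤ 2 * R / ε := by positivity
                          linarith) hcard
  exact_mod_cast (key.trans h1).trans hM

end Good

namespace Good
variable {d N : ℕ} {Ω : Set (Fin d → ℝ)} {μ : Measure (Fin d → ℝ)}
    {X : Submodule ℝ ((Fin d → ℝ) → ℝ)} {K1 K2 : ℝ}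

lemma int_le_one {q : ℝ} (hq : 1 ≤ q) {f : (Fin d → ℝ) → ℝ} (hf : lqNorm μ Ω q f ≤ 1) :
    ∫ x in Ω, |f x| ^ q ∂μ ≤ 1 := by
  have hnn : 0 ≤ ∫ x in Ω, |f x| ^ q ∂μ := integral_nonneg fun x => by positivity
  unfold lqNorm at hf
  by_contra h
  push Not at h
  have := Real.one_lt_rpow h (show 0 < 1 / q by positivity)
  linarith

lemma interp (G : Good N Ω μ X K1 K2) {q : ℝ} (hq : 1 ≤ q) (hq2 : q ≤ 2) {f : (Fin d → ℝ) → ℝ}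
    (hf : f ∈ X) (s : ℝ) (hs : supNorm Ω f ≤ s) :
    ∫ x in Ω, f x ^ 2 ∂μ ≤ s ^ (2 - q) * ∫ x in Ω, |f x| ^ q ∂μ := by
  rw [← integral_const_mul]
  have hs0 : 0 ≤ s := (supNorm_nonneg f).trans hs
  apply integral_mono_ae (G.sq_int hf) ((G.pow_int hf (by linarith)).const_mul _)
  filter_upwards [ae_restrict_mem G.hΩ.measurableSet] with x hx
  have h1 := (G.le_sup hf hx).trans hs
  have h2 : f x ^ 2 = |f x| ^ (2 - q) * |f x| ^ q := by
    rw [← Real.rpow_add' (abs_nonneg _) (by norm_num)]; simp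
  rw [h2]
  have := Real.rpow_le_rpow (abs_nonneg (f x)) h1 (show 0 ≤ 2 - q by linarith)
  gcongr

lemma sup_q (G : Good N Ω μ X K1 K2) {q : ℝ} (hq : 1 ≤ q) (hq2 : q ≤ 2) {f : (Fin d → ℝ) → ℝ}
    (hf : f ∈ X) (hfq : lqNorm μ Ω q f ≤ 1) : supNorm Ω f ≤ (K1 * N) ^ (1 / q) := by
  have hK1 := G.hK1
  have hKN : 0 ≤ K1 * N := by positivity
  rcases (supNorm_nonneg (Ω := Ω) f).eq_or_lt with h0 | h0
  · rw [← h0]; positivity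
  set s := supNorm Ω f with hs
  have h1 := G.sup_sq hf
  have h2 := G.interp hq hq2 hf s le_rfl
  have h3 := int_le_one hq hfq
  have h4 : s ^ 2 ≤ K1 * N * s ^ (2 - q) := by
    refine h1.trans (mul_le_mul_of_nonneg_left (h2.trans ?_) hKN)
    exact mul_le_of_le_one_right (by positivity) h3
  have h5 : s ^ 2 = s ^ q * s ^ (2 - q) := by
    rw [← Real.rpow_add h0]; simp
  rw [h5] at h4
  have h6 : s ^ q ≤ K1 * N := le_of_mul_le_mul_right h4 (by positivity)
  calc s = (s ^ q) ^ (1 / q) := by rw [← Real.rpow_mul h0.le, mul_one_div_cancel (by linarith), Real.rpow_one]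
    _ ≤ _ := Real.rpow_le_rpow (by positivity) h6 (by positivity)

lemma diff_int (G : Good N Ω μ X K1 K2) {q : ℝ} (hq : 1 ≤ q) (hq2 : q ≤ 2) {f g : (Fin d → ℝ) → ℝ}
    (hf : f ∈ X) (hg : g ∈ X) (hfq : lqNorm μ Ω q f ≤ 1) (hgq : lqNorm μ Ω q g ≤ 1) :
    ∫ x in Ω, |(f - g) x| ^ q ∂μ ≤ 8 := by
  have hq0 : 0 < q := by linarith
  have h1 := int_le_one hq hfq
  have h2 := int_le_one hq hgq
  have hI := (G.pow_int hf hq0).add (G.pow_int hg hq0)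
  calc ∫ x in Ω, |(f - g) x| ^ q ∂μ ≤ ∫ x in Ω, 4 * (|f x| ^ q + |g x| ^ q) ∂μ := by
        apply integral_mono_ae (G.pow_int (X.sub_mem hf hg) hq0) (hI.const_mul 4)
        refine Filter.Eventually.of_forall fun x => ?_
        simp only [Pi.sub_apply]
        have a1 : |f x - g x| ≤ 2 * max |f x| |g x| := by
          have := abs_sub (f x) (g x)
          have := le_max_left |f x| |g x|
          have := le_max_right |f x| |g x|
          linarith
        calc |f x - g x| ^ q ≤ (2 * max |f x| |g x|) ^ q := Real.rpow_le_rpow (abs_nonneg _) a1 hq0.le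
          _ = 2 ^ q * (max |f x| |g x|) ^ q := Real.mul_rpow (by norm_num) (by positivity)
          _ ≤ 4 * (|f x| ^ q + |g x| ^ q) := by
            have b1 : (2 : ℝ) ^ q ≤ 4 := by
              calc (2 : ℝ) ^ q ≤ 2 ^ (2 : ℝ) := Real.rpow_le_rpow_of_exponent_le (by norm_num) hq2
                _ = 4 := by norm_num
            have b2 : (max |f x| |g x|) ^ q ≤ |f x| ^ q + |g x| ^ q := by
              have : 0 ≤ |f x| ^ q := by positivity
              have : 0 ≤ |g x| ^ q := by positivity
              rcases max_choice |f x| |g x| with h | h <;> rw [h] <;> linarith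
            gcongr
    _ = 4 * (∫ x in Ω, |f x| ^ q ∂μ + ∫ x in Ω, |g x| ^ q ∂μ) := by
        rw [integral_const_mul, integral_add (G.pow_int hf hq0) (G.pow_int hg hq0)]
    _ ≤ 8 := by linarith

/-- The unit ball of `X` in `L_q`. -/
def ball (μ : Measure (Fin d → ℝ)) (Ω : Set (Fin d → ℝ)) (X : Submodule ℝ ((Fin d → ℝ) → ℝ)) (q : ℝ) :
    Set ((Fin d → ℝ) → ℝ) := {f | f ∈ X ∧ lqNorm μ Ω q f ≤ 1}

lemma zero_mem_ball {q : ℝ} (hq : 1 ≤ q) : (0 : (Fin d → ℝ) → ℝ) ∈ ball μ Ω X q := by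
  have hq0 : q ≠ 0 := by linarith
  refine ⟨X.zero_mem, ?_⟩
  simp [lqNorm, Real.zero_rpow hq0, Real.zero_rpow (inv_ne_zero hq0)]

lemma base (G : Good N Ω μ X K1 K2) {q : ℝ} (hq : 1 ≤ q) (hq2 : q ≤ 2) :
    Pk Ω (ball μ Ω X q) (2 ^ 14 * (K1 * K2 ^ 2 * Real.log N * N / 2) ^ (1 / q)) 1 := by
  have hK1 := G.hK1
  have hK2 := G.hK2
  have hN' : (2 : ℝ) ≤ N := by exact_mod_cast G.hN
  have hlog : Real.log 2 ≤ Real.log N := Real.log_le_log (by norm_num) hN'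
  have hl2 := Real.log_two_gt_d9
  have hqi : 1 / q ≤ 1 := by rw [div_le_one (by linarith)]; exact hq
  apply Pk_one
  intro f hf g hg
  have h1 := G.sup_q hq hq2 hf.1 hf.2
  have h2 := G.sup_q hq hq2 hg.1 hg.2
  have h3 : supNorm Ω (f - g) ≤ 2 * (K1 * N) ^ (1 / q) := by
    apply G.sup_le
    intro x hx
    have a1 := abs_sub (f x) (g x)
    have a2 := G.le_sup hf.1 hx
    have a3 := G.le_sup hg.1 hx
    simp only [Pi.sub_apply]
    linarith
  have h4 : K1 * N ≤ 4 * (K1 * K2 ^ 2 * Real.log N * N / 2) := by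
    have a1 : 1 ≤ K2 ^ 2 := one_le_pow₀ hK2.le
    have a2 : (1 : ℝ) / 2 ≤ K2 ^ 2 * Real.log N := by nlinarith
    have a3 : 0 < K1 * N := by positivity
    nlinarith
  have hQ : 0 ≤ K1 * K2 ^ 2 * Real.log N * N / 2 := by
    have : 0 ≤ Real.log N := by linarith
    positivity
  have h5 : (K1 * N) ^ (1 / q) ≤ 4 * (K1 * K2 ^ 2 * Real.log N * N / 2) ^ (1 / q) := by
    calc (K1 * N) ^ (1 / q) ≤ (4 * (K1 * K2 ^ 2 * Real.log N * N / 2)) ^ (1 / q) :=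
          Real.rpow_le_rpow (by positivity) h4 (by positivity)
      _ = 4 ^ (1 / q) * (K1 * K2 ^ 2 * Real.log N * N / 2) ^ (1 / q) :=
          Real.mul_rpow (by norm_num) hQ
      _ ≤ _ := by
          gcongr
          calc (4 : ℝ) ^ (1 / q) ≤ 4 ^ (1 : ℝ) := Real.rpow_le_rpow_of_exponent_le (by norm_num) hqi
            _ = 4 := by norm_num
  have h6 : 0 ≤ (K1 * K2 ^ 2 * Real.log N * N / 2) ^ (1 / q) := by positivity
  linarith

lemma step (G : Good N Ω μ X K1 K2) {q : ℝ} (hq : 1 ≤ q) (hq2 : q ≤ 2) (k : ℕ) (hk : 2 ≤ k)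
    (h : Pk Ω (ball μ Ω X q) (2 ^ 14 * (K1 * K2 ^ 2 * Real.log N * N / k) ^ (1 / q)) (2 ^ k)) :
    Pk Ω (ball μ Ω X q) (2 ^ 14 * (K1 * K2 ^ 2 * Real.log N * N / (2 * k : ℕ)) ^ (1 / q)) (2 ^ (2 * k)) := by
  have hK1 := G.hK1
  have hK2 := G.hK2
  have hN' : (2 : ℝ) ≤ N := by exact_mod_cast G.hN
  have hlog : 0 < Real.log N := Real.log_pos (by linarith)
  have hqi : 1 / q ≤ 1 := by rw [div_le_one (by linarith)]; exact hq
  have hk' : (2 : ℝ) ≤ k := by exact_mod_cast hk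
  set Q := K1 * K2 ^ 2 * Real.log N * N with hQdef
  have hQ : 0 < Q := by positivity
  set ε := (2 : ℝ) ^ 14 * (Q / k) ^ (1 / q) with hε
  set ε' := (2 : ℝ) ^ 14 * (Q / (2 * k : ℕ)) ^ (1 / q) with hε'
  have hε0 : 0 < ε := by positivity
  have hε0' : 0 < ε' := by
    have : (0 : ℝ) < (2 * k : ℕ) := by push_cast; linarith
    positivity
  have hεε : ε ≤ 2 * ε' := by
    have e1 : Q / k = 2 * (Q / (2 * k : ℕ)) := by push_cast; field_simp
    have hnn : 0 ≤ Q / (2 * k : ℕ) := by positivity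
    have h2 : (2 : ℝ) ^ (1 / q) ≤ 2 := by
      calc (2 : ℝ) ^ (1 / q) ≤ 2 ^ (1 : ℝ) := Real.rpow_le_rpow_of_exponent_le (by norm_num) hqi
        _ = 2 := by norm_num
    have h3 : 0 ≤ (Q / (2 * k : ℕ)) ^ (1 / q) := by positivity
    rw [hε, hε', e1, Real.mul_rpow (by norm_num) hnn]
    nlinarith
  have hεq : 2 ^ 14 * (Q / k) ≤ ε ^ q := by
    have hnn : 0 ≤ Q / k := by positivity
    rw [hε, Real.mul_rpow (by norm_num) (by positivity), ← Real.rpow_mul hnn,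
      one_div_mul_cancel (by linarith), Real.rpow_one]
    gcongr
    calc (2 : ℝ) ^ 14 = (2 ^ 14) ^ (1 : ℝ) := by norm_num
      _ ≤ _ := Real.rpow_le_rpow_of_exponent_le (by norm_num) hq
  rw [two_mul k, pow_add]
  refine h.combine hε0.le ?_
  intro f₀ hf₀
  refine G.pack_l2 (fun f hf => hf.1.1) f₀ hf₀.1 (ε ^ (2 - q) * 8) ε' hε0' ?_ _ ?_
  · intro f hf
    refine (G.interp hq hq2 (X.sub_mem hf.1.1 hf₀.1) ε hf.2).trans ?_
    gcongr
    exact G.diff_int hq hq2 hf.1.1 hf₀.1 hf.1.2 hf₀.2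
  · have e2 : ε ^ (2 - q) * ε ^ q = ε ^ 2 := by
      rw [← Real.rpow_add hε0]; simp
    have hpos : 0 < ε ^ (2 - q) := by positivity
    have b1 : ε ^ (2 - q) * (2 ^ 14 * (Q / k)) ≤ 4 * ε' ^ 2 := by
      calc _ ≤ ε ^ (2 - q) * ε ^ q := by gcongr
        _ = ε ^ 2 := e2
        _ ≤ (2 * ε') ^ 2 := by gcongr
        _ = _ := by ring
    have b2 : 128 * Q * (ε ^ (2 - q) * 8) / ε' ^ 2 ≤ k / 4 := by
      rw [div_le_iff₀ (by positivity)]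
      have : ε ^ (2 - q) * (2 ^ 14 * (Q / k)) * k = 2 ^ 14 * ε ^ (2 - q) * Q := by field_simp
      have b3 := mul_le_mul_of_nonneg_right b1 (show (0 : ℝ) ≤ k by positivity)
      rw [this] at b3
      nlinarith
    have hl2 := Real.log_two_gt_d9
    calc 2 * Real.exp (128 * Q * (ε ^ (2 - q) * 8) / ε' ^ 2)
        ≤ 2 * Real.exp (Real.log 2 * (k - 1)) := by
          gcongr
          refine b2.trans ?_
          nlinarith
      _ = Real.exp (Real.log 2) * Real.exp (Real.log 2 * (k - 1)) := by rw [Real.exp_log (by norm_num)]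
      _ = Real.exp (Real.log 2 * k) := by rw [← Real.exp_add]; congr 1; ring
      _ = ((2 ^ k : ℕ) : ℝ) := by
          rw [Real.exp_mul, Real.exp_log (by norm_num), Real.rpow_natCast]; push_cast; rfl
      _ ≤ _ := le_rfl

lemma dyadic (G : Good N Ω μ X K1 K2) {q : ℝ} (hq : 1 ≤ q) (hq2 : q ≤ 2) (m : ℕ) :
    Pk Ω (ball μ Ω X q) (2 ^ 14 * (K1 * K2 ^ 2 * Real.log N * N / (2 ^ (m + 1) : ℕ)) ^ (1 / q))
      (2 ^ (2 ^ (m + 1))) := by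
  induction m with
  | zero =>
    refine (G.base hq hq2).mono ?_ (by norm_num)
    norm_num
  | succ m ih =>
    have := G.step hq hq2 (2 ^ (m + 1)) (by rw [pow_succ]; have := Nat.one_le_two_pow (n := m); omega) ih
    rwa [← pow_succ'] at this

lemma allk (G : Good N Ω μ X K1 K2) {q : ℝ} (hq : 1 ≤ q) (hq2 : q ≤ 2) (k : ℕ) (hk : 1 ≤ k) :
    Pk Ω (ball μ Ω X q) (2 ^ 15 * (K1 * K2 ^ 2 * Real.log N * N / k) ^ (1 / q)) (2 ^ k) := by
  have hK1 := G.hK1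
  have hK2 := G.hK2
  have hN' : (2 : ℝ) ≤ N := by exact_mod_cast G.hN
  have hlog : 0 < Real.log N := Real.log_pos (by linarith)
  have hqi : 1 / q ≤ 1 := by rw [div_le_one (by linarith)]; exact hq
  set Q := K1 * K2 ^ 2 * Real.log N * N with hQdef
  have hQ : 0 < Q := by positivity
  have hk0 : (0 : ℝ) < k := by exact_mod_cast hk
  -- comparison of the radii
  have cmp : ∀ y : ℝ, 0 < y → (k : ℝ) ≤ 2 * y →
      (2 : ℝ) ^ 14 * (Q / y) ^ (1 / q) ≤ 2 ^ 15 * (Q / k) ^ (1 / q) := by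
    intro y hy hky
    have h1 : Q / y ≤ 2 * (Q / k) := by
      rw [← mul_div_assoc, div_le_div_iff₀ hy hk0]
      nlinarith
    have h2 : (2 : ℝ) ^ (1 / q) ≤ 2 := by
      calc (2 : ℝ) ^ (1 / q) ≤ 2 ^ (1 : ℝ) := Real.rpow_le_rpow_of_exponent_le (by norm_num) hqi
        _ = 2 := by norm_num
    have h3 : (Q / y) ^ (1 / q) ≤ 2 * (Q / k) ^ (1 / q) := by
      calc (Q / y) ^ (1 / q) ≤ (2 * (Q / k)) ^ (1 / q) :=
            Real.rpow_le_rpow (by positivity) h1 (by positivity)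
        _ = 2 ^ (1 / q) * (Q / k) ^ (1 / q) := Real.mul_rpow (by norm_num) (by positivity)
        _ ≤ _ := by gcongr
    linarith
  rcases Nat.lt_or_ge k 2 with h | h
  · have : k = 1 := by omega
    subst this
    refine (G.base hq hq2).mono ?_ (by norm_num)
    exact cmp 2 (by norm_num) (by norm_num)
  · have hm1 : 1 ≤ Nat.log 2 k := Nat.log_pos (by norm_num) h
    obtain ⟨m, hm⟩ : ∃ m, Nat.log 2 k = m + 1 := ⟨Nat.log 2 k - 1, by omega⟩
    have h1 : 2 ^ (m + 1) ≤ k := by rw [← hm]; exact Nat.pow_log_le_self 2 (by omega)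
    have h2 : k ≤ 2 * 2 ^ (m + 1) := by
      rw [← hm, ← pow_succ']; exact (Nat.lt_pow_succ_log_self (by norm_num) k).le
    refine (G.dyadic hq hq2 m).mono ?_ (Nat.pow_le_pow_right (by norm_num) h1)
    apply cmp
    · positivity
    · exact_mod_cast h2

lemma main1 (G : Good N Ω μ X K1 K2) {q : ℝ} (hq : 1 ≤ q) (hq2 : q ≤ 2) (k : ℕ) (hk : 1 ≤ k) :
    entNum (ball μ Ω X q) (supNorm Ω) k ≤
      2 ^ 18 * (K1 * K2 ^ 2 * Real.log N) ^ (1 / q) * ((N : ℝ) / (k : ℝ)) ^ (1 / q) := by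
  have hK1 := G.hK1
  have hK2 := G.hK2
  have hN' : (2 : ℝ) ≤ N := by exact_mod_cast G.hN
  have hlog : 0 < Real.log N := Real.log_pos (by linarith)
  have hk0 : (0 : ℝ) < k := by exact_mod_cast hk
  refine ((G.allk hq hq2 k hk).entNum_le (by positivity) (zero_mem_ball hq)).trans ?_
  rw [mul_div_assoc, Real.mul_rpow (by positivity) (by positivity), ← mul_assoc]
  gcongr
  all_goals norm_num

lemma main2 (G : Good N Ω μ X K1 K2) {q : ℝ} (hq : 1 ≤ q) (hq2 : q ≤ 2) (k : ℕ) (hk : N < k) :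
    entNum (ball μ Ω X q) (supNorm Ω) k ≤
      2 ^ 18 * (K1 * K2 ^ 2 * Real.log N) ^ (1 / q) * (2 : ℝ) ^ (-(k : ℝ) / (N : ℝ)) := by
  have hK1 := G.hK1
  have hK2 := G.hK2
  have hN := G.hN
  have hN' : (2 : ℝ) ≤ N := by exact_mod_cast G.hN
  have hN0 : (N : ℝ) ≠ 0 := by linarith
  have hlog : 0 < Real.log N := Real.log_pos (by linarith)
  set R := 2 ^ 15 * (K1 * K2 ^ 2 * Real.log N) ^ (1 / q) with hR
  have hR0 : 0 < R := by positivity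
  have h1 := G.allk hq hq2 N (by omega)
  rw [mul_div_assoc, div_self hN0, mul_one, ← hR] at h1
  set ε := 8 * R * (2 : ℝ) ^ (-(k : ℝ) / (N : ℝ)) with hε
  have hε0 : 0 < ε := by positivity
  have e : 2 ^ 18 * (K1 * K2 ^ 2 * Real.log N) ^ (1 / q) * (2 : ℝ) ^ (-(k : ℝ) / (N : ℝ)) = ε := by
    rw [hε, hR]; ring
  rw [e]
  have h2 : Pk Ω (ball μ Ω X q) ε (2 ^ N * 2 ^ (k - N)) := by
    refine h1.combine hR0.le ?_
    intro f₀ hf₀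
    rcases le_or_gt (2 * R) ε with h | h
    · refine (Pk_one ?_).mono le_rfl Nat.one_le_two_pow
      intro f hf g hg
      refine le_trans ?_ h
      apply G.sup_le
      intro x hx
      have a2 := (G.le_sup (X.sub_mem hf.1.1 hf₀.1) hx).trans hf.2
      have a3 := (G.le_sup (X.sub_mem hg.1.1 hf₀.1) hx).trans hg.2
      have a1 := abs_sub ((f - f₀) x) ((g - f₀) x)
      have e : (f - g) x = (f - f₀) x - (g - f₀) x := by simp
      rw [e]
      linarith
    · refine G.pack_vol (fun f hf => hf.1.1) f₀ hf₀.1 R ε hR0 hε0 (fun f hf => hf.2) _ ?_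
      have a1 : 1 + 2 * R / ε ≤ 4 * R / ε := by
        have : 1 ≤ 2 * R / ε := by rw [le_div_iff₀ hε0]; linarith
        have e : 4 * R / ε = 2 * R / ε + 2 * R / ε := by ring
        linarith
      have a2 : 4 * R / ε = (2 : ℝ) ^ ((k : ℝ) / N) / 2 := by
        have : (2 : ℝ) ^ (-(k : ℝ) / N) * (2 : ℝ) ^ ((k : ℝ) / N) = 1 := by
          rw [← Real.rpow_add (by norm_num), neg_div, neg_add_cancel, Real.rpow_zero]
        rw [div_eq_div_iff hε0.ne' (by norm_num), hε]
        linear_combination (-8 * R) * this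
      calc (1 + 2 * R / ε) ^ N ≤ (4 * R / ε) ^ N := by gcongr
        _ = (2 : ℝ) ^ k / 2 ^ N := by
          rw [a2, div_pow, ← Real.rpow_mul_natCast (by norm_num), div_mul_cancel₀ _ hN0, Real.rpow_natCast]
        _ = (2 : ℝ) ^ (k - N) := by
          rw [pow_sub₀ _ (by norm_num) hk.le]; rfl
        _ ≤ _ := by push_cast; exact le_rfl
  rw [← pow_add, Nat.add_sub_cancel' hk.le] at h2
  exact h2.entNum_le hε0 (zero_mem_ball hq)

end Good

/-! ### Degenerate cases -/

lemma entNum_nonpos_of {d : ℕ} {Ω : Set (Fin d → ℝ)} {A : Set ((Fin d → ℝ) → ℝ)} {k : ℕ}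
    (h0 : (0 : (Fin d → ℝ) → ℝ) ∈ A) (T : Finset ((Fin d → ℝ) → ℝ)) (h1 : ∀ f ∈ T, f ∈ A)
    (h2 : T.card ≤ 2 ^ k) (h3 : ∀ x ∈ A, ∃ y ∈ T, supNorm Ω (x - y) ≤ 0) :
    entNum A (supNorm Ω) k ≤ 0 := by
  refine le_of_forall_pos_le_add fun ε hε => ?_
  rw [zero_add]
  exact entNum_le_of_cover hε h0 T h1 h2 fun x hx => by
    obtain ⟨y, hy, hxy⟩ := h3 x hx
    exact ⟨y, hy, hxy.trans hε.le⟩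

lemma entNum_triv {d : ℕ} {Ω : Set (Fin d → ℝ)} {μ : Measure (Fin d → ℝ)}
    {X : Submodule ℝ ((Fin d → ℝ) → ℝ)} {q : ℝ} (hq : 1 ≤ q) (k : ℕ)
    (h : ∀ f ∈ X, supNorm Ω f ≤ 0) : entNum (Good.ball μ Ω X q) (supNorm Ω) k ≤ 0 := by
  refine entNum_nonpos_of (Good.zero_mem_ball hq) {0} ?_ ?_ ?_
  · intro f hf
    rw [Finset.mem_singleton.1 hf]
    exact Good.zero_mem_ball hq
  · simpa using Nat.one_le_two_pow
  · intro x hx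
    exact ⟨0, by simp, by rw [sub_zero]; exact h x hx.1⟩

lemma supNorm_unbdd {d : ℕ} {Ω : Set (Fin d → ℝ)} {f : (Fin d → ℝ) → ℝ}
    (h : ¬ BddAbove (Set.range fun x : Ω => |f x.1|)) : supNorm Ω f = 0 :=
  Real.iSup_of_not_bddAbove h

lemma bdd_sub {d : ℕ} {Ω : Set (Fin d → ℝ)} {f g : (Fin d → ℝ) → ℝ}
    (hf : BddAbove (Set.range fun x : Ω => |f x.1|))
    (hg : BddAbove (Set.range fun x : Ω => |(f - g) x.1|)) :
    BddAbove (Set.range fun x : Ω => |g x.1|) := by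
  obtain ⟨a, ha⟩ := hf
  obtain ⟨b, hb⟩ := hg
  refine ⟨a + b, ?_⟩
  rintro _ ⟨x, rfl⟩
  have h1 : |f x.1| ≤ a := ha ⟨x, rfl⟩
  have h2 : |(f - g) x.1| ≤ b := hb ⟨x, rfl⟩
  have h3 := abs_sub (f x.1) ((f - g) x.1)
  have e : f x.1 - (f - g) x.1 = g x.1 := by simp
  rw [e] at h3
  show |g x.1| ≤ a + b
  linarith

lemma lqNorm_smul {d : ℕ} {Ω : Set (Fin d → ℝ)} {μ : Measure (Fin d → ℝ)} {q : ℝ} (hq : 1 ≤ q)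
    (c : ℝ) (hc : 0 ≤ c) (f : (Fin d → ℝ) → ℝ) : lqNorm μ Ω q (c • f) = c * lqNorm μ Ω q f := by
  unfold lqNorm
  have : ∀ x, |(c • f) x| ^ q = c ^ q * |f x| ^ q := by
    intro x
    rw [Pi.smul_apply, smul_eq_mul, abs_mul, abs_of_nonneg hc, Real.mul_rpow hc (abs_nonneg _)]
  simp_rw [this]
  rw [integral_const_mul, Real.mul_rpow (by positivity) (integral_nonneg fun x => by positivity),
    ← Real.rpow_mul hc, mul_one_div_cancel (by linarith), Real.rpow_one]

lemma entNum_unbdd {d : ℕ} {Ω : Set (Fin d → ℝ)} {μ : Measure (Fin d → ℝ)}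
    {X : Submodule ℝ ((Fin d → ℝ) → ℝ)} {q : ℝ} (hq : 1 ≤ q) (k : ℕ) (hk : 1 ≤ k)
    (f : (Fin d → ℝ) → ℝ) (hf : f ∈ X) (h : ¬ BddAbove (Set.range fun x : Ω => |f x.1|)) :
    entNum (Good.ball μ Ω X q) (supNorm Ω) k ≤ 0 := by
  classical
  set L := lqNorm μ Ω q f with hL
  have hL0 : 0 ≤ L := by
    rw [hL]; unfold lqNorm
    exact Real.rpow_nonneg (integral_nonneg fun x => by positivity) _
  set g := (1 + L)⁻¹ • f with hg
  have hgA : g ∈ Good.ball μ Ω X q := by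
    refine ⟨X.smul_mem _ hf, ?_⟩
    rw [hg, lqNorm_smul hq _ (by positivity), ← hL, inv_mul_le_one₀ (by positivity)]
    linarith
  have hgu : ¬ BddAbove (Set.range fun x : Ω => |g x.1|) := by
    rintro ⟨b, hb⟩
    apply h
    refine ⟨(1 + L) * b, ?_⟩
    rintro _ ⟨x, rfl⟩
    have h1 : |g x.1| ≤ b := hb ⟨x, rfl⟩
    rw [hg, Pi.smul_apply, smul_eq_mul, abs_mul, abs_of_nonneg (by positivity),
      inv_mul_le_iff₀ (by positivity)] at h1
    exact h1
  refine entNum_nonpos_of (Good.zero_mem_ball hq) {0, g} ?_ ?_ ?_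
  · intro f hf
    rcases Finset.mem_insert.1 hf with h | h
    · rw [h]; exact Good.zero_mem_ball hq
    · rw [Finset.mem_singleton.1 h]; exact hgA
  · refine Finset.card_le_two.trans ?_
    calc 2 = 2 ^ 1 := by norm_num
      _ ≤ 2 ^ k := Nat.pow_le_pow_right (by norm_num) hk
  · intro x hx
    by_cases hb : BddAbove (Set.range fun y : Ω => |x y.1|)
    · refine ⟨g, by simp, le_of_eq (supNorm_unbdd fun h' => hgu (bdd_sub hb h'))⟩
    · refine ⟨0, by simp, le_of_eq (supNorm_unbdd ?_)⟩
      rwa [sub_zero]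

/-- **Theorem 3.1 of the paper.** Under the Nikol'skii-type conditions
`‖f‖_∞ ≤ (K1·N)^{1/2}‖f‖_2` and `‖f‖_∞ ≤ K2·‖f‖_{log N}` on an `N`-dimensional subspace
`X_N ⊂ L_∞(Ω)`, for each `1 ≤ q ≤ 2` the entropy numbers of the unit `L_q` ball satisfy
`ε_k(X_N^q, L_∞) ≤ C(q) (K1 K2² log N)^{1/q} (N/k)^{1/q}` for `k ≤ N` and
`≤ C(q) (K1 K2² log N)^{1/q} 2^{-k/N}` for `k > N`. -/
theorem stmt_7 (q : ℝ) (hq1 : 1 ≤ q) (hq2 : q ≤ 2) :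
    ∃ C : ℝ, 0 < C ∧
      ∀ (d N : ℕ) (Ω : Set (Fin d → ℝ)) (_ : IsCompact Ω)
        (μ : Measure (Fin d → ℝ)) (_ : IsProbabilityMeasure μ) (_ : μ Ωᶜ = 0)
        (X : Submodule ℝ ((Fin d → ℝ) → ℝ)) (_ : Module.finrank ℝ X = N)
        (K1 K2 : ℝ) (_ : 1 < K1) (_ : 1 < K2),
        (∀ f ∈ X, supNorm Ω f ≤ (K1 * N) ^ ((1 : ℝ) / 2) * lqNorm μ Ω 2 f) →
        (∀ f ∈ X, supNorm Ω f ≤ K2 * lqNorm μ Ω (Real.log N) f) →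
        (∀ k : ℕ, 1 ≤ k → k ≤ N →
          entNum {f | f ∈ X ∧ lqNorm μ Ω q f ≤ 1} (supNorm Ω) k ≤
            C * (K1 * K2 ^ 2 * Real.log N) ^ (1 / q) * ((N : ℝ) / (k : ℝ)) ^ (1 / q)) ∧
        (∀ k : ℕ, N < k →
          entNum {f | f ∈ X ∧ lqNorm μ Ω q f ≤ 1} (supNorm Ω) k ≤
            C * (K1 * K2 ^ 2 * Real.log N) ^ (1 / q) * (2 : ℝ) ^ (-(k : ℝ) / (N : ℝ))) := by
  refine ⟨2 ^ 18, by norm_num, ?_⟩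
  intro d N Ω hΩ μ hμ hc X hX K1 K2 hK1 hK2 h1 h2
  have hlog : 0 ≤ Real.log N := Real.log_natCast_nonneg N
  -- it suffices that every entropy number is nonpositive in the degenerate cases
  have triv : (∀ k : ℕ, 1 ≤ k → entNum (Good.ball μ Ω X q) (supNorm Ω) k ≤ 0) →
      (∀ k : ℕ, 1 ≤ k → k ≤ N →
          entNum {f | f ∈ X ∧ lqNorm μ Ω q f ≤ 1} (supNorm Ω) k ≤
            2 ^ 18 * (K1 * K2 ^ 2 * Real.log N) ^ (1 / q) * ((N : ℝ) / (k : ℝ)) ^ (1 / q)) ∧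
        (∀ k : ℕ, N < k →
          entNum {f | f ∈ X ∧ lqNorm μ Ω q f ≤ 1} (supNorm Ω) k ≤
            2 ^ 18 * (K1 * K2 ^ 2 * Real.log N) ^ (1 / q) * (2 : ℝ) ^ (-(k : ℝ) / (N : ℝ))) := by
    intro h
    refine ⟨fun k hk _ => (h k hk).trans (by positivity), fun k hk => (h k (by omega)).trans (by positivity)⟩
  by_cases hb : ∀ f ∈ X, BddAbove (Set.range fun x : Ω => |f x.1|)
  · rcases Nat.lt_or_ge N 2 with hN | hN
    · apply triv
      intro k _
      apply entNum_triv hq1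
      intro f hf
      rcases (show N = 0 ∨ N = 1 by omega) with h | h
      · have := h1 f hf
        rw [h] at this
        simpa using this
      · by_contra hpos
        push Not at hpos
        have hlo : Real.log (N : ℝ) = 0 := by rw [h]; simp
        set s := supNorm Ω f with hs
        have hcf := h2 (((K2 + 1) / s) • f) (X.smul_mem _ hf)
        have e1 : lqNorm μ Ω (Real.log N) (((K2 + 1) / s) • f) = 1 := by
          unfold lqNorm
          rw [hlo]
          simp
        have e2 : supNorm Ω (((K2 + 1) / s) • f) = K2 + 1 := by
          have hpos' : 0 ≤ (K2 + 1) / s := by positivity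
          have : supNorm Ω (((K2 + 1) / s) • f) = (K2 + 1) / s * s := by
            rw [hs]
            unfold supNorm
            rw [Real.mul_iSup_of_nonneg (by rw [hs] at hpos'; exact hpos')]
            simp only [Pi.smul_apply, smul_eq_mul, abs_mul]
            congr 1; ext x
            rw [abs_of_nonneg (by rw [hs] at hpos'; exact hpos')]
          rw [this]; field_simp
        rw [e1, e2] at hcf
        linarith
    · have G : Good N Ω μ X K1 K2 := ⟨hN, hΩ, hμ, hc, hX, hK1, hK2, h1, h2, hb⟩
      exact ⟨fun k hk _ => G.main1 hq1 hq2 k hk, fun k hk => G.main2 hq1 hq2 k hk⟩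
  · push Not at hb
    obtain ⟨f, hf, hfb⟩ := hb
    exact triv fun k hk => entNum_unbdd hq1 k hk f hf hfb
end
end

section
/- Let q ∈ [1,2] and let γ = (γ_1,…,γ_d) satisfy 1 = γ_1 = … = γ_ν < γ_{ν+1} ≤ … ≤ γ_d. There is a constant C(q,γ) > 0 such that for all n ∈ ℕ and all 1 ≤ k ≤ |Q_n^γ|, the entropy numbers of the unit L_q ball of the real hyperbolic cross polynomials RT(Q_n^γ) in the uniform norm satisfy ε_k(RT(Q_n^γ)^q, L_∞) ≤ C(q,γ)·n^{1/q}·(|Q_n^γ|/k)^{1/q}. -/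
noncomputable section
open MeasureTheory

/-- The fundamental cell `[0, 2π)^d` of the torus `𝕋^d`. -/
def torusCell (d : ℕ) : Set (Fin d → ℝ) := Set.univ.pi fun _ => Set.Ico 0 (2 * Real.pi)

/-- Normalized Lebesgue (probability) measure on the torus `𝕋^d = [0,2π)^d`. -/
def torusMeasure (d : ℕ) : Measure (Fin d → ℝ) :=
  (ENNReal.ofReal ((2 * Real.pi) ^ d))⁻¹ • (volume.restrict (torusCell d))

/-- The `L_q` norm on the torus with respect to the normalized Lebesgue measure. -/
def torusLq (d : ℕ) (q : ℝ) {E : Type*} [NormedAddCommGroup E] (f : (Fin d → ℝ) → E) : ℝ :=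
  (∫ x, ‖f x‖ ^ q ∂(torusMeasure d)) ^ (1 / q)

/-- The uniform norm on the torus of a real-valued function. -/
def torusSup (d : ℕ) (f : (Fin d → ℝ) → ℝ) : ℝ := ⨆ x : torusCell d, |f x.1|

/-- The step hyperbolic cross `Q_n^γ = ∪_{s : (γ,s) ≤ n} ρ(s)` where
`ρ(s) = {k : ⌊2^{s_j-1}⌋ ≤ |k_j| < 2^{s_j}}`. -/
def hyperbolicCross (d : ℕ) (γ : Fin d → ℝ) (n : ℕ) : Set (Fin d → ℤ) :=
  {k | ∃ s : Fin d → ℕ, (∑ j, γ j * (s j : ℝ)) ≤ (n : ℝ) ∧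
    ∀ j, ⌊(2 : ℝ) ^ ((s j : ℤ) - 1)⌋ ≤ |k j| ∧ |k j| < 2 ^ (s j)}

/-- `f` is a real trigonometric polynomial with frequencies in `Q`. -/
def IsRealTrigPoly (d : ℕ) (Q : Set (Fin d → ℤ)) (f : (Fin d → ℝ) → ℝ) : Prop :=
  ∃ F : Finset (Fin d → ℤ), ↑F ⊆ Q ∧ ∃ c : (Fin d → ℤ) → ℂ,
    ∀ x, (f x : ℂ) = ∑ k ∈ F, c k * Complex.exp (Complex.I * ∑ j, (k j : ℂ) * (x j : ℂ))

/-- Unnormalised Gaussian weight. -/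
def gw {ι : Type*} [Fintype ι] (x : ι → ℝ) : ENNReal := ENNReal.ofReal (Real.exp (-(∑ i, x i ^ 2) / 2))

lemma gw_meas {ι : Type*} [Fintype ι] : Measurable (gw : (ι → ℝ) → ENNReal) := by
  unfold gw; fun_prop

lemma gw_meas_add {ι : Type*} [Fintype ι] (y : ι → ℝ) : Measurable (fun x => gw (x + y)) :=
  gw_meas.comp (measurable_id.add_const y)

lemma gw_meas_sub {ι : Type*} [Fintype ι] (y : ι → ℝ) : Measurable (fun x => gw (x - y)) :=
  gw_meas.comp (measurable_id.sub_const y)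

lemma gw_fin {ι : Type*} [Fintype ι] : ∫⁻ x : ι → ℝ, gw x < ⊤ := by
  have h : Integrable (fun x : ι → ℝ => Real.exp (-(∑ i, x i ^ 2) / 2)) := by
    have h1 : Integrable (fun x : ι → ℝ => ∏ i, Real.exp (-(1/2) * (x i) ^ 2)) := by
      apply Integrable.fintype_prod (f := fun (_ : ι) (t : ℝ) => Real.exp (-(1/2) * t ^ 2))
      intro i
      exact integrable_exp_neg_mul_sq (by norm_num)
    refine h1.congr (Filter.Eventually.of_forall fun x => ?_)
    simp only
    rw [← Real.exp_sum, ← Finset.mul_sum]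
    congr 1; ring
  exact h.lintegral_lt_top

lemma gw_pos {ι : Type*} [Fintype ι] : 0 < ∫⁻ x : ι → ℝ, gw x := by
  rw [lintegral_pos_iff_support gw_meas]
  have : Function.support (gw : (ι → ℝ) → ENNReal) = Set.univ := by
    ext x; simp [gw, Real.exp_pos]
  rw [this]
  exact isOpen_univ.measure_pos volume Set.univ_nonempty

/-- Gaussian tail. -/
lemma gw_tail {ι : Type*} [Fintype ι] (v : ι → ℝ) (R2 l : ℝ) (hR : 0 < R2) (hl : 0 < l)
    (hv : ∑ i, v i ^ 2 ≤ R2) :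
    ∫⁻ x in {x : ι → ℝ | l < ∑ i, x i * v i}, gw x ≤
      ENNReal.ofReal (Real.exp (-(l ^ 2 / (2 * R2)))) * ∫⁻ x : ι → ℝ, gw x := by
  have hm : MeasurableSet {x : ι → ℝ | l < ∑ i, x i * v i} :=
    measurableSet_lt measurable_const (by fun_prop)
  set s := l / R2 with hs
  have hspos : 0 < s := by positivity
  calc ∫⁻ x in {x : ι → ℝ | l < ∑ i, x i * v i}, gw x
      ≤ ∫⁻ x in {x : ι → ℝ | l < ∑ i, x i * v i},
          ENNReal.ofReal (Real.exp (-(l ^ 2 / (2 * R2)))) * gw (x - s • v) := by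
        apply setLIntegral_mono
        · exact (measurable_const.mul (gw_meas.comp (measurable_id.sub_const _)))
        · intro x hx
          simp only [Set.mem_ofPred_eq] at hx
          unfold gw
          rw [← ENNReal.ofReal_mul (Real.exp_pos _).le, ← Real.exp_add]
          apply ENNReal.ofReal_le_ofReal
          apply Real.exp_le_exp.2
          have e : ∑ i, (x - s • v) i ^ 2 = ∑ i, x i ^ 2 - 2 * s * ∑ i, x i * v i + s ^ 2 * ∑ i, v i ^ 2 := by
            rw [Finset.mul_sum, Finset.mul_sum, ← Finset.sum_sub_distrib, ← Finset.sum_add_distrib]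
            apply Finset.sum_congr rfl; intro i _
            simp; ring
          rw [e]
          have h1 : s * l ≤ s * ∑ i, x i * v i := by gcongr
          have h2 : s ^ 2 * ∑ i, v i ^ 2 ≤ s ^ 2 * R2 := by gcongr
          have h3 : s ^ 2 * R2 = l ^ 2 / R2 := by rw [hs]; field_simp
          have h4 : s * l = l ^ 2 / R2 := by rw [hs]; field_simp
          have h5 : l ^ 2 / (2 * R2) = (l ^ 2 / R2) / 2 := by field_simp
          linarith
    _ ≤ ∫⁻ x : ι → ℝ, ENNReal.ofReal (Real.exp (-(l ^ 2 / (2 * R2)))) * gw (x - s • v) :=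
        setLIntegral_le_lintegral _ _
    _ = _ := by
        rw [lintegral_const_mul _ (gw_meas_sub _)]
        congr 1
        exact lintegral_sub_right_eq_self (fun x => gw x) (s • v)

/-- Gaussian measure of a shifted symmetric set. -/
lemma gw_shift {ι : Type*} [Fintype ι] (y : ι → ℝ) (A : Set (ι → ℝ)) (hA : MeasurableSet A)
    (hs : ∀ x ∈ A, -x ∈ A) :
    ENNReal.ofReal (Real.exp (-(∑ i, y i ^ 2) / 2)) * ∫⁻ x in A, gw x ≤
      ∫⁻ x in {x | x - y ∈ A}, gw x := by
  have hA' : MeasurableSet {x | x - y ∈ A} := (measurable_id.sub_const y) hA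
  have e1 : ∫⁻ x in {x | x - y ∈ A}, gw x = ∫⁻ x in A, gw (x + y) := by
    rw [← lintegral_indicator hA', ← lintegral_indicator hA]
    rw [← lintegral_add_right_eq_self _ y]
    apply lintegral_congr; intro x
    have hiff : (x + y ∈ {x | x - y ∈ A}) ↔ x ∈ A := by
      rw [Set.mem_ofPred_eq, add_sub_cancel_right]
    by_cases hx : x ∈ A
    · rw [Set.indicator_of_mem (hiff.2 hx), Set.indicator_of_mem hx]
    · rw [Set.indicator_of_notMem (fun h => hx (hiff.1 h)), Set.indicator_of_notMem hx]
  have e2 : ∫⁻ x in A, gw (x + y) = ∫⁻ x in A, gw (x - y) := by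
    rw [← lintegral_indicator hA, ← lintegral_indicator hA]
    rw [← lintegral_neg_eq_self]
    apply lintegral_congr; intro x
    have : (-x ∈ A) ↔ x ∈ A := ⟨fun h => by simpa using hs _ h, hs x⟩
    have h2 : gw (-x + y) = gw (x - y) := by
      unfold gw
      congr 4
      apply Finset.sum_congr rfl; intro i _; simp; ring
    by_cases hx : x ∈ A
    · rw [Set.indicator_of_mem (this.2 hx), Set.indicator_of_mem hx, h2]
    · rw [Set.indicator_of_notMem (fun h => hx (this.1 h)), Set.indicator_of_notMem hx]
  have e3 : 2 * ∫⁻ x in A, gw (x + y) = ∫⁻ x in A, (gw (x + y) + gw (x - y)) := by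
    rw [lintegral_add_left (gw_meas_add _), ← e2, two_mul]
  have e4 : ∫⁻ x in A, 2 * (ENNReal.ofReal (Real.exp (-(∑ i, y i ^ 2) / 2)) * gw x) ≤
      ∫⁻ x in A, (gw (x + y) + gw (x - y)) := by
    apply lintegral_mono
    intro x
    simp only
    unfold gw
    rw [← ENNReal.ofReal_add (Real.exp_pos _).le (Real.exp_pos _).le, ← ENNReal.ofReal_mul (Real.exp_pos _).le,
      show (2 : ENNReal) = ENNReal.ofReal 2 by simp, ← ENNReal.ofReal_mul (by norm_num)]
    apply ENNReal.ofReal_le_ofReal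
    have f1 : -(∑ i, (x + y) i ^ 2) / 2 = -(∑ i, y i ^ 2) / 2 + -(∑ i, x i ^ 2) / 2 + -(∑ i, x i * y i) := by
      have : ∑ i, (x + y) i ^ 2 = ∑ i, y i ^ 2 + ∑ i, x i ^ 2 + 2 * ∑ i, x i * y i := by
        rw [Finset.mul_sum, ← Finset.sum_add_distrib, ← Finset.sum_add_distrib]
        apply Finset.sum_congr rfl; intro i _
        simp; ring
      rw [this]; ring
    have f2 : -(∑ i, (x - y) i ^ 2) / 2 = -(∑ i, y i ^ 2) / 2 + -(∑ i, x i ^ 2) / 2 + (∑ i, x i * y i) := by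
      have : ∑ i, (x - y) i ^ 2 = ∑ i, y i ^ 2 + ∑ i, x i ^ 2 - 2 * ∑ i, x i * y i := by
        rw [Finset.mul_sum, ← Finset.sum_add_distrib, ← Finset.sum_sub_distrib]
        apply Finset.sum_congr rfl; intro i _
        simp; ring
      rw [this]; ring
    rw [f1, f2, Real.exp_add _ (-(∑ i, x i * y i)), Real.exp_add _ ((∑ i, x i * y i)), Real.exp_add]
    set p := ∑ i, x i * y i
    have hp : 2 ≤ Real.exp (-p) + Real.exp p := by
      have h1 := Real.add_one_le_exp (-p)
      have h2 := Real.add_one_le_exp p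
      linarith
    have : 0 < Real.exp (-(∑ i, y i ^ 2) / 2) * Real.exp (-(∑ i, x i ^ 2) / 2) := by positivity
    nlinarith
  rw [e1]
  rw [← e3, lintegral_const_mul _ (gw_meas.const_mul _), lintegral_const_mul _ gw_meas] at e4
  exact (ENNReal.mul_le_mul_iff_right (by norm_num) (by norm_num)).1 e4

/-- Dual Sudakov packing bound. -/
lemma gauss_pack {ι X : Type*} [Fintype ι] (V : Finset X) (φ : X → ι → ℝ) (R2 l r2 t : ℝ)
    (hR : 0 < R2) (hl : 0 < l) (ht : 0 < t)
    (hφ : ∀ v ∈ V, ∑ i, φ v i ^ 2 ≤ R2)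
    (hV : 8 * (V.card : ℝ) * Real.exp (-(l ^ 2 / (2 * R2))) ≤ 1)
    {J : Type*} (S : Finset J) (a : J → ι → ℝ)
    (ha : ∀ j ∈ S, ∑ i, a j i ^ 2 ≤ r2)
    (hsep : ∀ j ∈ S, ∀ k ∈ S, j ≠ k → ∃ v ∈ V, t < |∑ i, (a j i - a k i) * φ v i|) :
    (S.card : ℝ) ≤ 4 / 3 * Real.exp (2 * l ^ 2 * r2 / t ^ 2) := by
  set A : Set (ι → ℝ) := {x | ∀ v ∈ V, |∑ i, x i * φ v i| ≤ l} with hAdef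
  have hAm : MeasurableSet A := by
    have : A = ⋂ v ∈ V, {x : ι → ℝ | |∑ i, x i * φ v i| ≤ l} := by
      ext x; simp [hAdef]
    rw [this]
    apply Finset.measurableSet_biInter
    intro v _
    exact measurableSet_le (by fun_prop) measurable_const
  have hAs : ∀ x ∈ A, -x ∈ A := by
    intro x hx v hv
    have := hx v hv
    simpa [Finset.sum_neg_distrib] using this
  set Z := ∫⁻ x : ι → ℝ, gw x with hZ
  set m := ∫⁻ x in A, gw x with hm
  have hZ0 : Z ≠ 0 := gw_pos.ne'
  have hZt : Z ≠ ⊤ := gw_fin.ne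
  have hmt : m ≠ ⊤ := ((setLIntegral_le_lintegral _ _).trans_lt gw_fin).ne
  set E := Real.exp (-(l ^ 2 / (2 * R2))) with hE
  have hcompl : ∫⁻ x in Aᶜ, gw x ≤ (V.card : ENNReal) * (2 * (ENNReal.ofReal E * Z)) := by
    have hsub : Aᶜ ⊆ ⋃ v ∈ V, ({x : ι → ℝ | l < ∑ i, x i * φ v i} ∪ {x : ι → ℝ | l < ∑ i, x i * (-φ v) i}) := by
      intro x hx
      simp only [hAdef, Set.mem_compl_iff, Set.mem_ofPred_eq, not_forall, not_le] at hx
      obtain ⟨v, hv, h⟩ := hx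
      simp only [Set.mem_iUnion]
      refine ⟨v, hv, ?_⟩
      rcases lt_abs.1 h with h | h
      · left; exact h
      · right; simpa [Finset.sum_neg_distrib] using h
    set μ := (volume : Measure (ι → ℝ)).withDensity gw with hμ
    have hw : ∀ s : Set (ι → ℝ), μ s = ∫⁻ x in s, gw x := fun s => withDensity_apply' _ s
    rw [← hw]
    refine (measure_mono hsub).trans ((measure_biUnion_finset_le _ _).trans ?_)
    refine (Finset.sum_le_card_nsmul _ _ (2 * (ENNReal.ofReal E * Z)) ?_).trans (by simp)
    intro v hv
    refine (measure_union_le _ _).trans ?_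
    rw [two_mul, hw, hw]
    exact add_le_add (gw_tail _ R2 l hR hl (hφ v hv)) (gw_tail _ R2 l hR hl (by simpa using hφ v hv))
  have hsum : m + ∫⁻ x in Aᶜ, gw x = Z := lintegral_add_compl _ hAm
  have hlow : (3 / 4) * Z.toReal ≤ m.toReal := by
    have h1 : Z ≤ m + (V.card : ENNReal) * (2 * (ENNReal.ofReal E * Z)) := by
      rw [← hsum]; gcongr; rw [hsum]; exact hcompl
    have h2 := ENNReal.toReal_mono (by finiteness) h1
    rw [ENNReal.toReal_add hmt (by finiteness)] at h2
    simp only [ENNReal.toReal_mul, ENNReal.toReal_natCast, ENNReal.toReal_ofNat, ENNReal.toReal_ofReal (Real.exp_pos _).le, hE] at h2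
    rw [← hE] at h2
    have : 0 ≤ Z.toReal := ENNReal.toReal_nonneg
    nlinarith
  set lam := 2 * l / t with hlam
  have hlampos : 0 < lam := by positivity
  -- disjoint shifted sets
  have hdisj : (S : Set J).PairwiseDisjoint (fun j => {x : ι → ℝ | x - lam • a j ∈ A}) := by
    intro j hj k hk hjk
    rw [Function.onFun, Set.disjoint_left]
    intro x hx hx'
    obtain ⟨v, hv, h⟩ := hsep j hj k hk hjk
    have h1 := hx v hv
    have h2 := hx' v hv
    have e : lam * ∑ i, (a j i - a k i) * φ v i =
        ∑ i, (x - lam • a k) i * φ v i - ∑ i, (x - lam • a j) i * φ v i := by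
      rw [Finset.mul_sum, ← Finset.sum_sub_distrib]
      apply Finset.sum_congr rfl; intro i _; simp; ring
    have h3 : lam * |∑ i, (a j i - a k i) * φ v i| ≤ 2 * l := by
      rw [show lam * |∑ i, (a j i - a k i) * φ v i| = |lam * ∑ i, (a j i - a k i) * φ v i| by
        rw [abs_mul, abs_of_pos hlampos], e]
      exact (abs_sub _ _).trans (by linarith)
    have h4 : lam * t = 2 * l := by rw [hlam]; field_simp
    nlinarith
  have htot : ∑ j ∈ S, ∫⁻ x in {x : ι → ℝ | x - lam • a j ∈ A}, gw x ≤ Z := by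
    rw [← lintegral_biUnion_finset hdisj (fun j _ => (measurable_id.sub_const _) hAm)]
    exact setLIntegral_le_lintegral _ _
  set D := Real.exp (-(2 * l ^ 2 * r2 / t ^ 2)) with hD
  have hlow2 : (S.card : ENNReal) * (ENNReal.ofReal D * m) ≤ Z := by
    refine le_trans ?_ htot
    have := Finset.card_nsmul_le_sum S (fun j => ∫⁻ x in {x : ι → ℝ | x - lam • a j ∈ A}, gw x) (ENNReal.ofReal D * m) ?_
    · simpa using this
    intro j hj
    refine le_trans ?_ (gw_shift (lam • a j) A hAm hAs)
    gcongr
    rw [hD]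
    apply Real.exp_le_exp.2
    have : ∑ i, (lam • a j) i ^ 2 = lam ^ 2 * ∑ i, a j i ^ 2 := by
      rw [Finset.mul_sum]; apply Finset.sum_congr rfl; intro i _; simp; ring
    rw [this]
    have h1 : lam ^ 2 * ∑ i, a j i ^ 2 ≤ lam ^ 2 * r2 := by
      have := ha j hj
      gcongr
    have h2 : lam ^ 2 * r2 = 2 * (2 * l ^ 2 * r2 / t ^ 2) := by rw [hlam]; field_simp
    linarith
  have h5 := ENNReal.toReal_mono hZt hlow2
  simp only [ENNReal.toReal_mul, ENNReal.toReal_natCast, ENNReal.toReal_ofReal (Real.exp_pos _).le, hD] at h5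
  rw [← hD] at h5
  have hZp : 0 < Z.toReal := ENNReal.toReal_pos hZ0 hZt
  have hDp : 0 < D := Real.exp_pos _
  have h6 : (S.card : ℝ) * (D * (3 / 4 * Z.toReal)) ≤ Z.toReal := le_trans (by gcongr) h5
  have h7 : (S.card : ℝ) * D ≤ 4 / 3 := by
    by_contra hc
    push Not at hc
    nlinarith
  have h8 : Real.exp (2 * l ^ 2 * r2 / t ^ 2) = D⁻¹ := by rw [hD, Real.exp_neg, inv_inv]
  rw [h8, ← div_eq_mul_inv, le_div_iff₀ hDp]
  exact h7

/-- The character `e^{i(k,x)}`. -/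
def ee {d : ℕ} (k : Fin d → ℤ) (x : Fin d → ℝ) : ℂ :=
  Complex.exp (Complex.I * ∑ j, (k j : ℂ) * (x j : ℂ))

lemma ee_eq {d : ℕ} (k : Fin d → ℤ) (x : Fin d → ℝ) :
    ee k x = Complex.exp (Complex.I * ((∑ j, (k j : ℝ) * x j : ℝ) : ℂ)) := by
  unfold ee; push_cast; rfl

lemma norm_ee {d : ℕ} (k : Fin d → ℤ) (x : Fin d → ℝ) : ‖ee k x‖ = 1 := by
  rw [ee_eq, mul_comm, Complex.norm_exp_ofReal_mul_I]

lemma continuous_ee {d : ℕ} (k : Fin d → ℤ) : Continuous (ee k) := by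
  unfold ee; fun_prop

lemma ee_mul_conj {d : ℕ} (k l : Fin d → ℤ) (x : Fin d → ℝ) :
    ee k x * (starRingEnd ℂ) (ee l x) = ee (k - l) x := by
  rw [ee_eq, ee_eq, ee_eq, ← Complex.exp_conj, ← Complex.exp_add]
  congr 1
  simp only [map_mul, Complex.conj_I, Complex.conj_ofReal]
  have : (∑ j, ((k - l) j : ℝ) * x j : ℝ) = ∑ j, (k j : ℝ) * x j - ∑ j, (l j : ℝ) * x j := by
    rw [← Finset.sum_sub_distrib]
    apply Finset.sum_congr rfl; intro j _; simp; ring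
  rw [this]; push_cast; ring

lemma vol_cell (d : ℕ) : volume (torusCell d) = ENNReal.ofReal ((2 * Real.pi) ^ d) := by
  unfold torusCell
  rw [volume_pi_pi]
  simp only [Real.volume_Ico, sub_zero, Finset.prod_const, Finset.card_univ, Fintype.card_fin]
  rw [ENNReal.ofReal_pow Real.two_pi_pos.le]

instance torus_prob (d : ℕ) : IsProbabilityMeasure (torusMeasure d) := by
  constructor
  have h : 0 < (2 * Real.pi) ^ d := pow_pos Real.two_pi_pos d
  unfold torusMeasure
  rw [Measure.smul_apply, Measure.restrict_apply_univ, vol_cell, smul_eq_mul]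
  exact ENNReal.inv_mul_cancel (by simpa using h) ENNReal.ofReal_ne_top

lemma cell_meas (d : ℕ) : MeasurableSet (torusCell d) :=
  MeasurableSet.univ_pi fun _ => measurableSet_Ico

lemma ae_cell (d : ℕ) : ∀ᵐ x ∂(torusMeasure d), x ∈ torusCell d := by
  unfold torusMeasure
  exact Measure.ae_smul_measure (ae_restrict_mem (cell_meas d)) _

lemma zero_mem_cell (d : ℕ) : (0 : Fin d → ℝ) ∈ torusCell d := by
  intro j _
  simp [Real.pi_pos]

lemma int_1d (m : ℤ) : ∫ t in Set.Ico 0 (2 * Real.pi), Complex.exp (Complex.I * ((m : ℂ) * (t : ℂ))) =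
    if m = 0 then ((2 * Real.pi : ℝ) : ℂ) else 0 := by
  rw [integral_Ico_eq_integral_Ioc, ← intervalIntegral.integral_of_le Real.two_pi_pos.le]
  split_ifs with h
  · subst h; simp
  · have hc : Complex.I * (m : ℂ) ≠ 0 := mul_ne_zero Complex.I_ne_zero (by exact_mod_cast h)
    simp_rw [← mul_assoc]
    rw [integral_exp_mul_complex hc]
    have : Complex.exp (Complex.I * (m : ℂ) * ((2 * Real.pi : ℝ) : ℂ)) = 1 := by
      rw [Complex.exp_eq_one_iff]
      exact ⟨m, by push_cast; ring⟩
    rw [this]; simp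

lemma int_ee {d : ℕ} (k : Fin d → ℤ) :
    ∫ x, ee k x ∂(torusMeasure d) = if k = 0 then 1 else 0 := by
  have hpi : 0 < (2 * Real.pi) ^ d := pow_pos Real.two_pi_pos d
  have h1 : ∫ x in torusCell d, ee k x = ∏ j, (if k j = 0 then ((2 * Real.pi : ℝ) : ℂ) else 0) := by
    have e : ∀ x : Fin d → ℝ, ee k x = ∏ j, Complex.exp (Complex.I * ((k j : ℂ) * (x j : ℂ))) := by
      intro x
      unfold ee
      rw [Finset.mul_sum, Complex.exp_sum]
    simp_rw [e]
    unfold torusCell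
    rw [volume_pi, Measure.restrict_pi_pi]
    rw [integral_fintype_prod_eq_prod (fun (j : Fin d) (t : ℝ) => Complex.exp (Complex.I * ((k j : ℂ) * (t : ℂ))))]
    apply Finset.prod_congr rfl
    intro j _
    exact int_1d (k j)
  unfold torusMeasure
  rw [integral_smul_measure, h1, ENNReal.toReal_inv, ENNReal.toReal_ofReal hpi.le]
  split_ifs with hk
  · subst hk
    simp only [Pi.zero_apply, if_true, Finset.prod_const, Finset.card_univ, Fintype.card_fin]
    rw [Complex.real_smul, ← Complex.ofReal_pow, ← Complex.ofReal_mul, inv_mul_cancel₀ hpi.ne']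
    simp
  · obtain ⟨j, hj⟩ : ∃ j, k j ≠ 0 := by
      by_contra h; push Not at h; exact hk (funext h)
    rw [Finset.prod_eq_zero (Finset.mem_univ j) (by simp [hj])]
    simp

/-- `f` has coefficients `c` on `QF`. -/
def HasCoef {d : ℕ} (QF : Finset (Fin d → ℤ)) (c : (Fin d → ℤ) → ℂ) (f : (Fin d → ℝ) → ℝ) : Prop :=
  ∀ x, (f x : ℂ) = ∑ k ∈ QF, c k * ee k x

lemma HasCoef.sub {d : ℕ} {QF : Finset (Fin d → ℤ)} {c c' : (Fin d → ℤ) → ℂ} {f g : (Fin d → ℝ) → ℝ}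
    (hf : HasCoef QF c f) (hg : HasCoef QF c' g) : HasCoef QF (c - c') (f - g) := by
  intro x
  simp only [Pi.sub_apply, Complex.ofReal_sub, hf x, hg x, sub_mul, Finset.sum_sub_distrib]

lemma HasCoef.continuous {d : ℕ} {QF : Finset (Fin d → ℤ)} {c : (Fin d → ℤ) → ℂ} {f : (Fin d → ℝ) → ℝ}
    (hf : HasCoef QF c f) : Continuous f := by
  have : f = fun x => (∑ k ∈ QF, c k * ee k x).re := by
    ext x; rw [← hf x]; simp
  rw [this]
  refine Complex.continuous_re.comp (continuous_finsetSum _ fun k _ => ?_)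
  exact continuous_const.mul (continuous_ee k)

lemma HasCoef.abs_le {d : ℕ} {QF : Finset (Fin d → ℤ)} {c : (Fin d → ℤ) → ℂ} {f : (Fin d → ℝ) → ℝ}
    (hf : HasCoef QF c f) (x : Fin d → ℝ) : |f x| ≤ ∑ k ∈ QF, ‖c k‖ := by
  rw [← Real.norm_eq_abs, ← Complex.norm_real, hf x]
  refine (norm_sum_le _ _).trans (Finset.sum_le_sum fun k _ => ?_)
  rw [norm_mul, norm_ee, mul_one]

lemma HasCoef.integrable {d : ℕ} {QF : Finset (Fin d → ℤ)} {c : (Fin d → ℤ) → ℂ} {f : (Fin d → ℝ) → ℝ}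
    (hf : HasCoef QF c f) {q : ℝ} (hq : 0 < q) : Integrable (fun x => |f x| ^ q) (torusMeasure d) := by
  refine Integrable.of_bound (C := (∑ k ∈ QF, ‖c k‖) ^ q) ?_ ?_
  · exact (hf.continuous.abs.rpow_const (fun _ => Or.inr hq.le)).aestronglyMeasurable
  · refine Filter.Eventually.of_forall fun x => ?_
    rw [Real.norm_of_nonneg (by positivity)]
    exact Real.rpow_le_rpow (abs_nonneg _) (hf.abs_le x) hq.le

lemma HasCoef.integrable_sq {d : ℕ} {QF : Finset (Fin d → ℤ)} {c : (Fin d → ℤ) → ℂ} {f : (Fin d → ℝ) → ℝ}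
    (hf : HasCoef QF c f) : Integrable (fun x => f x ^ 2) (torusMeasure d) := by
  refine (hf.integrable (q := 2) (by norm_num)).congr (Filter.Eventually.of_forall fun x => ?_)
  simp

lemma HasCoef.parseval {d : ℕ} {QF : Finset (Fin d → ℤ)} {c : (Fin d → ℤ) → ℂ} {f : (Fin d → ℝ) → ℝ}
    (hf : HasCoef QF c f) : ∫ x, f x ^ 2 ∂(torusMeasure d) = ∑ k ∈ QF, ‖c k‖ ^ 2 := by
  have e : ∀ x, ((f x ^ 2 : ℝ) : ℂ) = ∑ k ∈ QF, ∑ l ∈ QF, c k * (starRingEnd ℂ) (c l) * ee (k - l) x := by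
    intro x
    have h2 : (f x : ℂ) = ∑ l ∈ QF, (starRingEnd ℂ) (c l) * (starRingEnd ℂ) (ee l x) := by
      rw [← Complex.conj_ofReal, hf x, map_sum]
      simp only [map_mul]
    rw [pow_two, Complex.ofReal_mul]
    nth_rewrite 1 [hf x]
    rw [h2, Finset.sum_mul_sum]
    apply Finset.sum_congr rfl; intro k _
    apply Finset.sum_congr rfl; intro l _
    rw [← ee_mul_conj]; ring
  have hi : ∀ k : Fin d → ℤ, Integrable (ee k) (torusMeasure d) := fun k =>
    Integrable.of_bound (C := 1) (continuous_ee k).aestronglyMeasurable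
      (Filter.Eventually.of_forall fun x => (norm_ee k x).le)
  have h : ((∫ x, f x ^ 2 ∂(torusMeasure d) : ℝ) : ℂ) = ((∑ k ∈ QF, ‖c k‖ ^ 2 : ℝ) : ℂ) := by
    rw [← integral_complex_ofReal]
    simp_rw [e]
    rw [integral_finsetSum _ (fun k _ => integrable_finsetSum _ fun l _ => (hi _).const_mul _)]
    rw [Complex.ofReal_sum]
    apply Finset.sum_congr rfl; intro k hk
    rw [integral_finsetSum _ (fun l _ => (hi _).const_mul _)]
    simp_rw [integral_const_mul, int_ee, sub_eq_zero]
    simp only [mul_ite, mul_one, mul_zero, Finset.sum_ite_eq, hk, if_true]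
    rw [Complex.mul_conj, Complex.normSq_eq_norm_sq]
  exact_mod_cast h

lemma HasCoef.real_rep {d : ℕ} {QF : Finset (Fin d → ℤ)} {c : (Fin d → ℤ) → ℂ} {f : (Fin d → ℝ) → ℝ}
    (hf : HasCoef QF c f) (x : Fin d → ℝ) :
    f x = ∑ k ∈ QF, ((c k).re * (ee k x).re + (c k).im * -(ee k x).im) := by
  have : f x = (f x : ℂ).re := by simp
  rw [this, hf x, Complex.re_sum]
  apply Finset.sum_congr rfl; intro k _
  rw [Complex.mul_re]; ring

lemma sq_re_im (z : ℂ) : z.re ^ 2 + z.im ^ 2 = ‖z‖ ^ 2 := by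
  rw [← Complex.normSq_eq_norm_sq, Complex.normSq_apply]; ring

/-- L2 norm bounded by uniform norm and q-norm. -/
lemma HasCoef.l2_le {d : ℕ} {QF : Finset (Fin d → ℤ)} {c : (Fin d → ℤ) → ℂ} {f : (Fin d → ℝ) → ℝ}
    (hf : HasCoef QF c f) {q S B : ℝ} (hq : 1 ≤ q) (hq2 : q ≤ 2)
    (hS : ∀ x ∈ torusCell d, |f x| ≤ S) (hB : ∫ x, |f x| ^ q ∂(torusMeasure d) ≤ B) :
    ∫ x, f x ^ 2 ∂(torusMeasure d) ≤ S ^ (2 - q) * B := by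
  have hS0 : 0 ≤ S := (abs_nonneg _).trans (hS 0 (zero_mem_cell d))
  calc ∫ x, f x ^ 2 ∂(torusMeasure d) ≤ ∫ x, S ^ (2 - q) * |f x| ^ q ∂(torusMeasure d) := by
        apply integral_mono_ae hf.integrable_sq ((hf.integrable (by linarith)).const_mul _)
        filter_upwards [ae_cell d] with x hx
        have h1 : f x ^ 2 = |f x| ^ (2 - q) * |f x| ^ q := by
          rw [← Real.rpow_add' (abs_nonneg _) (by norm_num)]
          norm_num
        rw [h1]
        have h2 : |f x| ^ (2 - q) ≤ S ^ (2 - q) :=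
          Real.rpow_le_rpow (abs_nonneg _) (hS x hx) (by linarith)
        gcongr
    _ = S ^ (2 - q) * ∫ x, |f x| ^ q ∂(torusMeasure d) := integral_const_mul _ _
    _ ≤ _ := by gcongr

lemma HasCoef.bdd {d : ℕ} {QF : Finset (Fin d → ℤ)} {c : (Fin d → ℤ) → ℂ} {f : (Fin d → ℝ) → ℝ}
    (hf : HasCoef QF c f) : ∀ x ∈ torusCell d, |f x| ≤ torusSup d f := by
  intro x hx
  have : BddAbove (Set.range fun x : torusCell d => |f x.1|) :=
    ⟨_, by rintro _ ⟨y, rfl⟩; exact hf.abs_le y.1⟩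
  exact le_ciSup this ⟨x, hx⟩

lemma torusSup_le {d : ℕ} {f : (Fin d → ℝ) → ℝ} {S : ℝ} (h : ∀ x ∈ torusCell d, |f x| ≤ S) : torusSup d f ≤ S := by
  have : Nonempty (torusCell d) := ⟨⟨0, zero_mem_cell d⟩⟩
  exact ciSup_le fun x => h x.1 x.2

/-- Nikolskii inequality. -/
lemma HasCoef.nikolskii {d : ℕ} {QF : Finset (Fin d → ℤ)} {c : (Fin d → ℤ) → ℂ} {f : (Fin d → ℝ) → ℝ}
    (hf : HasCoef QF c f) {q : ℝ} (hq : 1 ≤ q) (hq2 : q ≤ 2)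
    (hB : ∫ x, |f x| ^ q ∂(torusMeasure d) ≤ 1) (x : Fin d → ℝ) (hx : x ∈ torusCell d) :
    |f x| ≤ (QF.card : ℝ) ^ (1 / q) := by
  refine (hf.bdd x hx).trans ?_
  set S := torusSup d f with hSdef
  have hS0 : 0 ≤ S := (abs_nonneg _).trans (hf.bdd x hx)
  rcases hS0.eq_or_lt with h0 | hpos
  · rw [← h0]; positivity
  have h2 := hf.l2_le hq hq2 hf.bdd hB
  have h3 : S ≤ ∑ k ∈ QF, ‖c k‖ := torusSup_le fun y _ => hf.abs_le y
  have h4 : (∑ k ∈ QF, ‖c k‖) ^ 2 ≤ QF.card * ∑ k ∈ QF, ‖c k‖ ^ 2 := sq_sum_le_card_mul_sum_sq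
  rw [← hf.parseval] at h4
  have h5 : S ^ 2 ≤ QF.card * S ^ (2 - q) := by
    calc S ^ 2 ≤ (∑ k ∈ QF, ‖c k‖) ^ 2 := by gcongr
      _ ≤ _ := h4
      _ ≤ _ := by gcongr; simpa using h2
  have h6 : S ^ q ≤ QF.card := by
    have : S ^ 2 = S ^ q * S ^ (2 - q) := by
      rw [← Real.rpow_add hpos]; norm_num
    rw [this] at h5
    exact le_of_mul_le_mul_right h5 (by positivity)
  calc S = (S ^ q) ^ (1 / q) := by
        rw [← Real.rpow_mul hS0, mul_one_div_cancel (by linarith), Real.rpow_one]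
    _ ≤ _ := by gcongr

/-- Discretisation of the uniform norm. -/
lemma grid_exists (d n L : ℕ) (QF : Finset (Fin d → ℤ)) (hQ : ∀ k ∈ QF, ∀ j, |(k j : ℝ)| ≤ 2 ^ n)
    (hL : 14 * (d * 2 ^ n * (QF.card : ℝ)) ≤ L) (hL0 : 0 < L) :
    ∃ V : Finset (Fin d → ℝ), V.card ≤ L ^ d ∧
      ∀ c f, HasCoef QF c f → ∀ s, (∀ v ∈ V, |f v| ≤ s) → ∀ x ∈ torusCell d, |f x| ≤ 2 * s := by
  classical
  have hLr : (0 : ℝ) < L := by exact_mod_cast hL0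
  set P : (Fin d → Fin L) → (Fin d → ℝ) := fun m j => 2 * Real.pi * (m j : ℕ) / L with hP
  refine ⟨Finset.univ.image P, Finset.card_image_le.trans (by simp), ?_⟩
  intro c f hf s hs
  set S := torusSup d f with hS
  have hS0 : 0 ≤ S := (abs_nonneg _).trans (hf.bdd 0 (zero_mem_cell d))
  have hck : ∀ k ∈ QF, ‖c k‖ ≤ S := by
    intro k hk
    have h1 : ‖c k‖ ^ 2 ≤ ∫ x, f x ^ 2 ∂(torusMeasure d) := by
      rw [hf.parseval]
      exact Finset.single_le_sum (f := fun k => ‖c k‖ ^ 2) (fun _ _ => by positivity) hk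
    have h2 : ∫ x, f x ^ 2 ∂(torusMeasure d) ≤ S ^ 2 := by
      calc _ ≤ ∫ x, S ^ 2 ∂(torusMeasure d) := by
            apply integral_mono_ae hf.integrable_sq (integrable_const _)
            filter_upwards [ae_cell d] with x hx
            rw [← sq_abs]
            have := hf.bdd x hx
            gcongr
        _ = S ^ 2 := by simp
    exact abs_le_of_sq_le_sq' (h1.trans h2) hS0 |>.2
  have key : ∀ x ∈ torusCell d, |f x| ≤ s + S / 2 := by
    intro x hx
    have hxj : ∀ j, 0 ≤ x j ∧ x j < 2 * Real.pi := fun j => hx j (Set.mem_univ j)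
    have hp := Real.two_pi_pos
    have hfl : ∀ j, ⌊x j * L / (2 * Real.pi)⌋₊ < L := by
      intro j
      rw [Nat.floor_lt (by have := (hxj j).1; positivity), div_lt_iff₀ hp, mul_comm]
      have := (hxj j).2
      gcongr
    set m : Fin d → Fin L := fun j => ⟨_, hfl j⟩ with hm
    set v := P m with hv
    have hvs : |f v| ≤ s := hs v (Finset.mem_image_of_mem _ (Finset.mem_univ _))
    have hdist : ∀ j, |x j - v j| ≤ 7 / L := by
      intro j
      have hy0 : 0 ≤ x j * L / (2 * Real.pi) := by have := (hxj j).1; positivity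
      have a1 := Nat.floor_le hy0
      have a2 := Nat.lt_floor_add_one (x j * L / (2 * Real.pi))
      set fl : ℝ := (⌊x j * L / (2 * Real.pi)⌋₊ : ℝ) with hfl'
      have hvj : v j = 2 * Real.pi * fl / L := rfl
      have hxx : x j = 2 * Real.pi * (x j * L / (2 * Real.pi)) / L := by field_simp
      have hd : x j - v j = 2 * Real.pi * (x j * L / (2 * Real.pi) - fl) / L := by
        rw [hvj]; nth_rewrite 1 [hxx]; ring
      rw [hd, abs_of_nonneg (by apply div_nonneg (mul_nonneg hp.le (by linarith)) hLr.le)]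
      gcongr
      have : Real.pi < 3.15 := Real.pi_lt_d2
      nlinarith
    have hee : ∀ k ∈ QF, ‖ee k x - ee k v‖ ≤ d * 2 ^ n * (7 / L) := by
      intro k hk
      have e1 : ee k x = ee k v * Complex.exp (Complex.I * ((∑ j, (k j : ℝ) * (x j - v j) : ℝ) : ℂ)) := by
        rw [ee_eq, ee_eq, ← Complex.exp_add]
        congr 1
        have : ∑ j, (k j : ℝ) * x j = ∑ j, (k j : ℝ) * v j + ∑ j, (k j : ℝ) * (x j - v j) := by
          rw [← Finset.sum_add_distrib]; apply Finset.sum_congr rfl; intro j _; ring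
        rw [this]; push_cast; ring
      have e2 : ee k x - ee k v = ee k v * (Complex.exp (Complex.I * ((∑ j, (k j : ℝ) * (x j - v j) : ℝ) : ℂ)) - 1) := by
        rw [e1]; ring
      rw [e2, norm_mul, norm_ee, one_mul]
      refine Real.norm_exp_I_mul_ofReal_sub_one_le.trans ?_
      refine (norm_sum_le _ _).trans ?_
      refine (Finset.sum_le_card_nsmul _ _ (2 ^ n * (7 / (L : ℝ))) ?_).trans
        (by rw [Finset.card_univ, Fintype.card_fin, nsmul_eq_mul, mul_assoc])
      intro j _
      rw [norm_mul, Real.norm_eq_abs, Real.norm_eq_abs]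
      have b1 := hQ k hk j
      have b2 := hdist j
      gcongr
    have hdiff : |f x - f v| ≤ S / 2 := by
      rw [← Real.norm_eq_abs, ← Complex.norm_real, Complex.ofReal_sub, hf x, hf v, ← Finset.sum_sub_distrib]
      refine (norm_sum_le _ _).trans ?_
      refine (Finset.sum_le_card_nsmul _ _ (S * (d * 2 ^ n * (7 / L))) ?_).trans ?_
      · intro k hk
        rw [← mul_sub, norm_mul]
        have := hck k hk
        have := hee k hk
        gcongr
      · rw [nsmul_eq_mul]
        have : (QF.card : ℝ) * (S * (d * 2 ^ n * (7 / L))) = S / 2 * ((14 * (d * 2 ^ n * (QF.card : ℝ))) / L) := by ring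
        rw [this]
        have : (14 * (d * 2 ^ n * (QF.card : ℝ))) / L ≤ 1 := by rw [div_le_one hLr]; exact hL
        calc _ ≤ S / 2 * 1 := by gcongr
          _ = _ := mul_one _
    have := abs_sub_abs_le_abs_sub (f x) (f v)
    linarith
  intro x hx
  have h1 := torusSup_le key
  have h2 := hf.bdd x hx
  linarith

/-- Uniform distance on the cell exceeds `t`. -/
def Far {d : ℕ} (t : ℝ) (f g : (Fin d → ℝ) → ℝ) : Prop := ∃ x ∈ torusCell d, t < |f x - g x|

lemma four_thirds (k : ℕ) (hk : 1 ≤ k) : 4 / 3 * Real.exp ((k : ℝ) / 4) ≤ 2 ^ k := by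
  have h1 : Real.exp (1 / 4) ≤ 3 / 2 := by
    have h := Real.exp_bound' (x := 1 / 4) (by norm_num) (by norm_num) (n := 2) (by norm_num)
    refine h.trans ?_
    norm_num [Finset.sum_range_succ]
  have h2 : Real.exp ((k : ℝ) / 4) = Real.exp (1 / 4) ^ k := by
    rw [← Real.exp_nat_mul]; congr 1; ring
  rw [h2]
  have h3 : Real.exp (1 / 4) ^ k ≤ (3 / 2) ^ k := by gcongr
  have h4 : (4 / 3 : ℝ) ≤ (4 / 3) ^ k := le_self_pow₀ (by norm_num) (by omega)
  calc 4 / 3 * Real.exp (1 / 4) ^ k ≤ (4 / 3) ^ k * (3 / 2) ^ k := by gcongr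
    _ = 2 ^ k := by rw [← mul_pow]; norm_num

lemma l2_pack {d : ℕ} (QF : Finset (Fin d → ℤ)) (hQF : 0 < QF.card) (V : Finset (Fin d → ℝ)) (M : ℝ) (hM : 0 < M)
    (hVM : 8 * (V.card : ℝ) ≤ Real.exp M)
    (hV : ∀ c f, HasCoef QF c f → ∀ s, (∀ v ∈ V, |f v| ≤ s) → ∀ x ∈ torusCell d, |f x| ≤ 2 * s)
    (S : Finset ((Fin d → ℝ) → ℝ)) (y : (Fin d → ℝ) → ℝ) (r2 t : ℝ) (ht : 0 < t)
    (hS : ∀ f ∈ S, (∃ c, HasCoef QF c (f - y)) ∧ ∫ x, (f - y) x ^ 2 ∂(torusMeasure d) ≤ r2)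
    (hfar : ∀ f ∈ S, ∀ g ∈ S, f ≠ g → Far t f g) (k : ℕ) (hk : 1 ≤ k)
    (hkt : 64 * M * QF.card * r2 ≤ k * t ^ 2) : S.card ≤ 2 ^ k := by
  have hN : (0 : ℝ) < QF.card := by exact_mod_cast hQF
  have hex : ∀ f : (Fin d → ℝ) → ℝ, ∃ c, f ∈ S → HasCoef QF c (f - y) := by
    intro f
    by_cases hf : f ∈ S
    · obtain ⟨c, hc⟩ := (hS f hf).1
      exact ⟨c, fun _ => hc⟩
    · exact ⟨0, fun h => absurd h hf⟩
  choose c hc using hex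
  set φ : (Fin d → ℝ) → (QF ⊕ QF) → ℝ :=
    fun v => Sum.elim (fun k => (ee k.1 v).re) (fun k => -(ee k.1 v).im) with hφ
  set a : ((Fin d → ℝ) → ℝ) → (QF ⊕ QF) → ℝ :=
    fun f => Sum.elim (fun k => (c f k.1).re) (fun k => (c f k.1).im) with ha
  have hl2 : Real.sqrt (2 * M * QF.card) ^ 2 = 2 * M * QF.card := Real.sq_sqrt (by positivity)
  have h := gauss_pack V φ QF.card (Real.sqrt (2 * M * QF.card)) r2 (t / 2) hN (by positivity) (by positivity)
    ?_ ?_ S a ?_ ?_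
  · have h2 : 2 * Real.sqrt (2 * M * QF.card) ^ 2 * r2 / (t / 2) ^ 2 ≤ (k : ℝ) / 4 := by
      rw [hl2, div_le_iff₀ (by positivity)]
      nlinarith
    have h3 : (S.card : ℝ) ≤ 2 ^ k := by
      refine h.trans (le_trans ?_ (four_thirds k hk))
      gcongr
    exact_mod_cast h3
  · intro v _
    rw [Fintype.sum_sum_type, ← Finset.sum_add_distrib]
    have : ∀ k : QF, φ v (Sum.inl k) ^ 2 + φ v (Sum.inr k) ^ 2 = 1 := by
      intro k
      simp only [hφ, Sum.elim_inl, Sum.elim_inr, neg_sq]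
      rw [sq_re_im, norm_ee]; norm_num
    simp only [this]
    simp
  · rw [hl2]
    have : 2 * M * QF.card / (2 * QF.card) = M := by field_simp
    rw [this, Real.exp_neg, ← div_eq_mul_inv, div_le_one (Real.exp_pos _)]
    exact hVM
  · intro f hf
    refine le_trans (le_of_eq ?_) (hS f hf).2
    rw [(hc f hf).parseval, Fintype.sum_sum_type, ← Finset.sum_add_distrib, ← Finset.sum_coe_sort QF]
    apply Finset.sum_congr rfl; intro k _
    exact sq_re_im _
  · intro f hf g hg hfg
    by_contra hcon
    push Not at hcon
    obtain ⟨x, hx, hxt⟩ := hfar f hf g hg hfg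
    have hco := (hc f hf).sub (hc g hg)
    have := hV _ _ hco (t / 2) (fun v hv => ?_) x hx
    · simp only [Pi.sub_apply, sub_sub_sub_cancel_right] at this
      linarith
    · refine le_trans (le_of_eq ?_) (hcon v hv)
      rw [hco.real_rep v, Fintype.sum_sum_type, ← Finset.sum_add_distrib, ← Finset.sum_coe_sort QF]
      congr 1

/-- Packing bound. -/
def PackLE {d : ℕ} (A : Set ((Fin d → ℝ) → ℝ)) (t : ℝ) (m : ℕ) : Prop :=
  ∀ S : Finset ((Fin d → ℝ) → ℝ), (∀ f ∈ S, f ∈ A) → (∀ f ∈ S, ∀ g ∈ S, f ≠ g → Far t f g) → S.card ≤ m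

lemma cover_of_pack {d : ℕ} {A : Set ((Fin d → ℝ) → ℝ)} {t : ℝ} {m : ℕ} (h : PackLE A t m) (ht : 0 ≤ t) :
    ∃ Y : Finset ((Fin d → ℝ) → ℝ), (∀ f ∈ Y, f ∈ A) ∧ Y.card ≤ m ∧
      ∀ f ∈ A, ∃ y ∈ Y, ∀ x ∈ torusCell d, |f x - y x| ≤ t := by
  classical
  by_contra hcon
  push Not at hcon
  have key : ∀ j ≤ m + 1, ∃ S : Finset ((Fin d → ℝ) → ℝ), (∀ f ∈ S, f ∈ A) ∧
      (∀ f ∈ S, ∀ g ∈ S, f ≠ g → Far t f g) ∧ S.card = j := by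
    intro j
    induction j with
    | zero => intro _; exact ⟨∅, by simp, by simp, by simp⟩
    | succ j ih =>
      intro hj
      obtain ⟨S, h1, h2, h3⟩ := ih (by omega)
      obtain ⟨f, hfA, hf⟩ := hcon S h1 (by omega)
      have hfS : f ∉ S := by
        intro hfS
        obtain ⟨x, _, hx⟩ := hf f hfS
        simp at hx
        linarith
      refine ⟨insert f S, ?_, ?_, ?_⟩
      · intro g hg
        rcases Finset.mem_insert.1 hg with rfl | hg
        · exact hfA
        · exact h1 g hg
      · intro g hg g' hg' hne
        rcases Finset.mem_insert.1 hg with e | hg <;> rcases Finset.mem_insert.1 hg' with e' | hg'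
        · exact absurd (e.trans e'.symm) hne
        · rw [e]; exact hf g' hg'
        · rw [e']
          obtain ⟨x, hx, hx'⟩ := hf g hg
          exact ⟨x, hx, by rwa [abs_sub_comm]⟩
        · exact h2 g hg g' hg' hne
      · rw [Finset.card_insert_of_notMem hfS, h3]
  obtain ⟨S, h1, h2, h3⟩ := key (m + 1) le_rfl
  have := h S h1 h2
  omega

/-- The unit ball. -/
def Bq {d : ℕ} (QF : Finset (Fin d → ℤ)) (q : ℝ) : Set ((Fin d → ℝ) → ℝ) :=
  {f | (∃ c, HasCoef QF c f) ∧ ∫ x, |f x| ^ q ∂(torusMeasure d) ≤ 1}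

lemma Bq_sub {d : ℕ} {QF : Finset (Fin d → ℤ)} {q : ℝ} (hq : 1 ≤ q) (hq2 : q ≤ 2)
    {f g : (Fin d → ℝ) → ℝ} (hf : f ∈ Bq QF q) (hg : g ∈ Bq QF q) :
    ∫ x, |(f - g) x| ^ q ∂(torusMeasure d) ≤ 8 := by
  obtain ⟨⟨c, hc⟩, hf1⟩ := hf
  obtain ⟨⟨c', hc'⟩, hg1⟩ := hg
  have hq0 : 0 < q := by linarith
  calc ∫ x, |(f - g) x| ^ q ∂(torusMeasure d)
      ≤ ∫ x, (4 * |f x| ^ q + 4 * |g x| ^ q) ∂(torusMeasure d) := by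
        apply integral_mono ((hc.sub hc').integrable hq0)
          (((hc.integrable hq0).const_mul 4).add ((hc'.integrable hq0).const_mul 4))
        intro x
        simp only [Pi.sub_apply, Pi.add_apply]
        have h2q : (2 : ℝ) ^ q ≤ 4 := by
          calc (2 : ℝ) ^ q ≤ 2 ^ (2 : ℝ) := Real.rpow_le_rpow_of_exponent_le (by norm_num) hq2
            _ = 4 := by norm_num
        have hfx : 0 ≤ |f x| ^ q := by positivity
        have hgx : 0 ≤ |g x| ^ q := by positivity
        have hab := abs_sub (f x) (g x)
        rcases le_total |f x| |g x| with h | h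
        · have : |f x - g x| ^ q ≤ (2 * |g x|) ^ q :=
            Real.rpow_le_rpow (abs_nonneg _) (by linarith) hq0.le
          rw [Real.mul_rpow (by norm_num) (abs_nonneg _)] at this
          nlinarith
        · have : |f x - g x| ^ q ≤ (2 * |f x|) ^ q :=
            Real.rpow_le_rpow (abs_nonneg _) (by linarith) hq0.le
          rw [Real.mul_rpow (by norm_num) (abs_nonneg _)] at this
          nlinarith
    _ = 4 * ∫ x, |f x| ^ q ∂(torusMeasure d) + 4 * ∫ x, |g x| ^ q ∂(torusMeasure d) := by
        rw [integral_add ((hc.integrable hq0).const_mul 4) ((hc'.integrable hq0).const_mul 4),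
          integral_const_mul, integral_const_mul]
    _ ≤ 8 := by linarith

/-- One doubling step. -/
lemma pack_step {d : ℕ} (QF : Finset (Fin d → ℤ)) (hQF : 0 < QF.card) (V : Finset (Fin d → ℝ)) (M : ℝ) (hM : 0 < M)
    (hVM : 8 * (V.card : ℝ) ≤ Real.exp M)
    (hV : ∀ c f, HasCoef QF c f → ∀ s, (∀ v ∈ V, |f v| ≤ s) → ∀ x ∈ torusCell d, |f x| ≤ 2 * s)
    (q : ℝ) (hq : 1 ≤ q) (hq2 : q ≤ 2) (k : ℕ) (hk : 1 ≤ k) (a t : ℝ) (ha : 0 < a) (ht : 0 < t)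
    (hat : 512 * M * QF.card * a ^ (2 - q) ≤ k * t ^ 2)
    (hP : PackLE (Bq QF q) a (2 ^ k)) : PackLE (Bq QF q) t (2 ^ (2 * k)) := by
  classical
  intro S hSA hSfar
  obtain ⟨Y, hYA, hYc, hY⟩ := cover_of_pack hP ha.le
  have hsub : S ⊆ Y.biUnion fun y => S.filter fun f => ∀ x ∈ torusCell d, |f x - y x| ≤ a := by
    intro f hf
    obtain ⟨y, hy, h⟩ := hY f (hSA f hf)
    exact Finset.mem_biUnion.2 ⟨y, hy, Finset.mem_filter.2 ⟨hf, h⟩⟩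
  calc S.card ≤ _ := Finset.card_le_card hsub
    _ ≤ Y.card * 2 ^ k := by
      apply Finset.card_biUnion_le_card_mul
      intro y hy
      apply l2_pack QF hQF V M hM hVM hV _ y (a ^ (2 - q) * 8) t ht _ _ k hk (by linarith)
      · intro f hf
        obtain ⟨hfS, hfy⟩ := Finset.mem_filter.1 hf
        obtain ⟨c, hc⟩ := (hSA f hfS).1
        obtain ⟨c', hc'⟩ := (hYA y hy).1
        refine ⟨⟨_, hc.sub hc'⟩, ?_⟩
        exact (hc.sub hc').l2_le hq hq2 hfy (Bq_sub hq hq2 (hSA f hfS) (hYA y hy))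
      · intro f hf g hg
        exact hSfar f (Finset.mem_filter.1 hf).1 g (Finset.mem_filter.1 hg).1
    _ ≤ 2 ^ k * 2 ^ k := by gcongr
    _ = 2 ^ (2 * k) := by rw [← pow_add]; congr 1; ring

lemma pack_all {d : ℕ} (QF : Finset (Fin d → ℤ)) (hQF : 0 < QF.card) (V : Finset (Fin d → ℝ)) (M : ℝ) (hM : 1 ≤ M)
    (hVM : 8 * (V.card : ℝ) ≤ Real.exp M)
    (hV : ∀ c f, HasCoef QF c f → ∀ s, (∀ v ∈ V, |f v| ≤ s) → ∀ x ∈ torusCell d, |f x| ≤ 2 * s)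
    (q : ℝ) (hq : 1 ≤ q) (hq2 : q ≤ 2) (m : ℕ) :
    PackLE (Bq QF q) (2048 * (M * QF.card / 2 ^ m) ^ (1 / q)) (2 ^ (2 ^ m)) := by
  have hN : (0 : ℝ) < QF.card := by exact_mod_cast hQF
  have hM0 : 0 < M := by linarith
  have hq0 : 0 < q := by linarith
  induction m with
  | zero =>
    intro S hSA hSfar
    have : S.card ≤ 1 := by
      rw [Finset.card_le_one]
      intro f hf g hg
      by_contra hne
      obtain ⟨x, hx, h⟩ := hSfar f hf g hg hne
      obtain ⟨⟨c, hc⟩, h1⟩ := hSA f hf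
      obtain ⟨⟨c', hc'⟩, h1'⟩ := hSA g hg
      have b1 := hc.nikolskii hq hq2 h1 x hx
      have b2 := hc'.nikolskii hq hq2 h1' x hx
      have b3 := abs_sub (f x) (g x)
      have b4 : (QF.card : ℝ) ^ (1 / q) ≤ (M * QF.card / 2 ^ 0) ^ (1 / q) := by
        apply Real.rpow_le_rpow hN.le _ (by positivity)
        rw [pow_zero, div_one]; nlinarith
      have b5 : 0 < (QF.card : ℝ) ^ (1 / q) := by positivity
      linarith
    exact this.trans (by norm_num)
  | succ m ih =>
    have e : 2 ^ (m + 1) = 2 * 2 ^ m := by rw [pow_succ]; ring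
    rw [show (2 ^ (2 ^ (m + 1)) : ℕ) = 2 ^ (2 * 2 ^ m) by rw [e]]
    refine pack_step QF hQF V M hM0 hVM hV q hq hq2 (2 ^ m) Nat.one_le_two_pow _ _ (by positivity) (by positivity) ?_ ih
    set u := M * QF.card / 2 ^ m with hu
    have hu0 : 0 < u := by positivity
    have hu2 : M * QF.card / 2 ^ (m + 1) = u / 2 := by rw [hu, pow_succ]; field_simp
    have hMN : M * QF.card = u * 2 ^ m := by rw [hu]; field_simp
    rw [hu2, show 512 * M * (QF.card : ℝ) = 512 * (M * QF.card) by ring, hMN]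
    push_cast
    clear_value u
    clear hu
    set w := u ^ (1 / q) with hw
    have hw0 : 0 < w := by positivity
    have h2 : (u / 2) ^ (1 / q) ≥ w / 2 := by
      rw [Real.div_rpow hu0.le (by norm_num)]
      have : (2 : ℝ) ^ (1 / q) ≤ 2 := by
        calc (2 : ℝ) ^ (1 / q) ≤ 2 ^ (1 : ℝ) := Real.rpow_le_rpow_of_exponent_le (by norm_num)
              (by rw [div_le_one hq0]; exact hq)
          _ = 2 := by norm_num
      show w / 2 ≤ w / 2 ^ (1 / q)
      gcongr
    have huw : u = w ^ q := by
      rw [hw, ← Real.rpow_mul hu0.le, one_div_mul_cancel hq0.ne', Real.rpow_one]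
    clear_value w
    clear hw
    have h3 : (2048 * w) ^ (2 - q) ≤ 2048 * w ^ (2 - q) := by
      rw [Real.mul_rpow (by norm_num) hw0.le]
      gcongr
      calc (2048 : ℝ) ^ (2 - q) ≤ 2048 ^ (1 : ℝ) :=
            Real.rpow_le_rpow_of_exponent_le (by norm_num) (by linarith)
        _ = 2048 := by norm_num
    have h4 : u * w ^ (2 - q) = w ^ 2 := by
      rw [huw, ← Real.rpow_add hw0]; norm_num
    calc 512 * (u * 2 ^ m) * (2048 * w) ^ (2 - q)
        ≤ 512 * (u * 2 ^ m) * (2048 * w ^ (2 - q)) := by gcongr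
      _ = 512 * 2048 * 2 ^ m * (u * w ^ (2 - q)) := by ring
      _ = 2 ^ m * (2048 * (w / 2)) ^ 2 := by rw [h4]; ring
      _ ≤ 2 ^ m * (2048 * (u / 2) ^ (1 / q)) ^ 2 := by gcongr

lemma one_le_gamma {d ν : ℕ} {γ : Fin d → ℝ}
    (hγ1 : ∀ j : Fin d, (j : ℕ) < ν → γ j = 1)
    (hγ2 : ∀ j : Fin d, ν ≤ (j : ℕ) → 1 < γ j) (j : Fin d) : 1 ≤ γ j := by
  rcases lt_or_ge (j : ℕ) ν with h | h
  · exact (hγ1 j h).ge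
  · exact (hγ2 j h).le

lemma cross_bound {d : ℕ} {γ : Fin d → ℝ} (hγ : ∀ j, 1 ≤ γ j) {n : ℕ} {k : Fin d → ℤ}
    (hk : k ∈ hyperbolicCross d γ n) (j : Fin d) : |k j| < 2 ^ n := by
  obtain ⟨s, hs, hk⟩ := hk
  have h1 : (s j : ℝ) ≤ n := by
    calc (s j : ℝ) ≤ γ j * s j := le_mul_of_one_le_left (by positivity) (hγ j)
      _ ≤ ∑ j, γ j * (s j : ℝ) :=
        Finset.single_le_sum (f := fun j => γ j * (s j : ℝ))
          (fun i _ => mul_nonneg (by linarith [hγ i]) (by positivity)) (Finset.mem_univ j)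
      _ ≤ n := hs
  have h2 : s j ≤ n := by exact_mod_cast h1
  exact (hk j).2.trans_le (pow_le_pow_right₀ (by norm_num) h2)

lemma cross_sub {d : ℕ} {γ : Fin d → ℝ} (hγ : ∀ j, 1 ≤ γ j) (n : ℕ) :
    hyperbolicCross d γ n ⊆ ↑(Fintype.piFinset fun _ : Fin d => Finset.Ioo (-(2 ^ n : ℤ)) (2 ^ n)) := by
  intro k hk
  rw [Finset.mem_coe, Fintype.mem_piFinset]
  intro j
  rw [Finset.mem_Ioo]
  exact abs_lt.1 (cross_bound hγ hk j)

lemma cross_card {d : ℕ} {γ : Fin d → ℝ} (hγ : ∀ j, 1 ≤ γ j) (n : ℕ) :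
    (hyperbolicCross d γ n).ncard ≤ (2 ^ (n + 1)) ^ d := by
  refine (Set.ncard_le_ncard (cross_sub hγ n) (Finset.finite_toSet _)).trans ?_
  rw [Set.ncard_coe_finset, Fintype.card_piFinset]
  simp only [Int.card_Ioo, Finset.prod_const, Finset.card_univ, Fintype.card_fin]
  apply Nat.pow_le_pow_left
  have : ((2 : ℤ) ^ n) = ((2 ^ n : ℕ) : ℤ) := by push_cast; rfl
  rw [this, pow_succ]
  omega

lemma entNum_le {d : ℕ} {A : Set ((Fin d → ℝ) → ℝ)} {t : ℝ} {m k : ℕ} (h : PackLE A t m) (ht : 0 < t)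
    (hm : m ≤ 2 ^ k) (hne : A.Nonempty) : entNum A (torusSup d) k ≤ t := by
  obtain ⟨Y, hYA, hYc, hY⟩ := cover_of_pack h ht.le
  apply csInf_le ⟨0, fun ε hε => hε.1.le⟩
  refine ⟨ht, ?_⟩
  obtain ⟨a0, ha0⟩ := hne
  let e := Y.equivFin
  refine ⟨fun i => if hi : (i : ℕ) < Y.card then (e.symm ⟨i, hi⟩).1 else a0, ?_, ?_⟩
  · intro i
    beta_reduce
    split_ifs with hi
    · exact hYA _ (e.symm ⟨i, hi⟩).2
    · exact ha0
  · intro f hf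
    obtain ⟨y, hy, hfy⟩ := hY f hf
    refine ⟨⟨e ⟨y, hy⟩, (e ⟨y, hy⟩).2.trans_le (hYc.trans hm)⟩, ?_⟩
    apply torusSup_le
    intro x hx
    simpa using hfy x hx

lemma grid_count (d n L : ℕ) (hn : 1 ≤ n) (hL : L = 14 * d * 2 ^ n * (2 ^ (n + 1)) ^ d) :
    8 * ((L ^ d : ℕ) : ℝ) ≤ Real.exp ((3 + d * (16 * d + 1)) * n) := by
  have hn' : (1 : ℝ) ≤ n := by exact_mod_cast hn
  have h2e : (2 : ℝ) ≤ Real.exp 1 := by linarith [Real.add_one_le_exp (1 : ℝ)]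
  have h2p : ∀ j : ℕ, (2 : ℝ) ^ j ≤ Real.exp j := by
    intro j
    rw [← Real.exp_one_pow]
    gcongr
  have h14 : (14 * d : ℝ) ≤ Real.exp (14 * d * n) := by
    have := Real.add_one_le_exp (14 * d * n : ℝ)
    have : (14 * d : ℝ) * 1 ≤ 14 * d * n := by gcongr
    linarith
  have hLe : (L : ℝ) ≤ Real.exp ((16 * d + 1) * n) := by
    rw [hL]; push_cast
    have h3 : ((2 : ℝ) ^ (n + 1)) ^ d ≤ Real.exp (2 * d * n) := by
      rw [← pow_mul]
      refine (h2p _).trans (Real.exp_le_exp.2 ?_)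
      push_cast
      have : (0 : ℝ) ≤ d := by positivity
      nlinarith
    calc (14 * d * 2 ^ n * ((2 : ℝ) ^ (n + 1)) ^ d) ≤ Real.exp (14 * d * n) * Real.exp n * Real.exp (2 * d * n) := by
          gcongr; exact h2p n
      _ = _ := by rw [← Real.exp_add, ← Real.exp_add]; congr 1; ring
  have h8 : (8 : ℝ) ≤ Real.exp (3 * n) := by
    have : (2 : ℝ) ^ 3 ≤ Real.exp (3 : ℕ) := h2p 3
    have h' : Real.exp (3 : ℕ) ≤ Real.exp (3 * n) := Real.exp_le_exp.2 (by push_cast; linarith)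
    linarith
  calc 8 * ((L ^ d : ℕ) : ℝ) ≤ Real.exp (3 * n) * Real.exp ((16 * d + 1) * n) ^ d := by
        push_cast; gcongr
    _ = _ := by rw [← Real.exp_nat_mul, ← Real.exp_add]; congr 1; ring

/-- **Proposition 3.1 of the paper.** Entropy numbers of the unit `L_q` ball of
the real hyperbolic cross polynomials in the uniform norm:
`ε_k(RT(Q_n^γ)^q, L_∞) ≤ C(q,γ) n^{1/q} (|Q_n^γ|/k)^{1/q}` for `1 ≤ k ≤ |Q_n^γ|`. -/
theorem stmt_8 (d ν : ℕ) (γ : Fin d → ℝ) (q : ℝ) (hq1 : 1 ≤ q) (hq2 : q ≤ 2)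
    (hν : 1 ≤ ν) (hνd : ν ≤ d)
    (hγ1 : ∀ j : Fin d, (j : ℕ) < ν → γ j = 1)
    (hγ2 : ∀ j : Fin d, ν ≤ (j : ℕ) → 1 < γ j)
    (hγmono : Monotone γ) :
    ∃ C : ℝ, 0 < C ∧
      ∀ n k : ℕ, 1 ≤ n → 1 ≤ k → k ≤ (hyperbolicCross d γ n).ncard →
        entNum {f : (Fin d → ℝ) → ℝ |
            IsRealTrigPoly d (hyperbolicCross d γ n) f ∧ torusLq d q f ≤ 1}
          (torusSup d) k ≤
          C * (n : ℝ) ^ (1 / q) *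
            (((hyperbolicCross d γ n).ncard : ℝ) / (k : ℝ)) ^ (1 / q) := by
  classical
  have hγ := one_le_gamma hγ1 hγ2
  have hd : 1 ≤ d := hν.trans hνd
  have hq0 : 0 < q := by linarith
  set K : ℝ := 3 + d * (16 * d + 1) with hK
  have hK1 : 1 ≤ K := by
    have : (0 : ℝ) ≤ d * (16 * d + 1) := by positivity
    linarith
  refine ⟨2048 * (2 * K) ^ (1 / q), by positivity, ?_⟩
  intro n k hn hk hkN
  have hn' : (1 : ℝ) ≤ n := by exact_mod_cast hn
  have hfin : (hyperbolicCross d γ n).Finite := (Finset.finite_toSet _).subset (cross_sub hγ n)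
  set QF := hfin.toFinset with hQF
  have hcard : (hyperbolicCross d γ n).ncard = QF.card := Set.ncard_eq_toFinset_card _ hfin
  have hcb := cross_card hγ n
  rw [hcard] at hkN hcb ⊢
  have hQ0 : 0 < QF.card := by omega
  have hN : (0 : ℝ) < QF.card := by exact_mod_cast hQ0
  set L : ℕ := 14 * d * 2 ^ n * (2 ^ (n + 1)) ^ d with hL
  have hg1 : ∀ l ∈ QF, ∀ j, |(l j : ℝ)| ≤ 2 ^ n := by
    intro l hl j
    have := (cross_bound hγ (hfin.mem_toFinset.1 hl) j).le
    exact_mod_cast this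
  have hg2 : 14 * (d * 2 ^ n * (QF.card : ℝ)) ≤ L := by
    rw [hL]; push_cast
    have : (QF.card : ℝ) ≤ (2 ^ (n + 1)) ^ d := by exact_mod_cast hcb
    calc 14 * (d * 2 ^ n * (QF.card : ℝ)) ≤ 14 * (d * 2 ^ n * (2 ^ (n + 1)) ^ d) := by gcongr
      _ = _ := by ring
  obtain ⟨V, hVc, hV⟩ := grid_exists d n L QF hg1 hg2 (by positivity)
  have hVM : 8 * (V.card : ℝ) ≤ Real.exp (K * n) := by
    refine le_trans ?_ (grid_count d n L hn hL)
    gcongr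
  have hA : {f : (Fin d → ℝ) → ℝ | IsRealTrigPoly d (hyperbolicCross d γ n) f ∧ torusLq d q f ≤ 1} ⊆ Bq QF q := by
    rintro f ⟨⟨F, hF, c, hc⟩, hf⟩
    refine ⟨⟨fun l => if l ∈ F then c l else 0, fun x => ?_⟩, ?_⟩
    · rw [hc x]
      have hFQ : F ⊆ QF := fun l hl => hfin.mem_toFinset.2 (hF hl)
      rw [← Finset.sum_subset hFQ]
      · apply Finset.sum_congr rfl; intro l hl; simp only [hl, if_true]; rfl
      · intro l _ hl; simp [hl]
    · unfold torusLq at hf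
      simp only [Real.norm_eq_abs] at hf
      by_contra hcon
      push Not at hcon
      have := Real.one_lt_rpow hcon (show 0 < 1 / q by positivity)
      linarith
  have hne : (0 : (Fin d → ℝ) → ℝ) ∈ {f : (Fin d → ℝ) → ℝ | IsRealTrigPoly d (hyperbolicCross d γ n) f ∧ torusLq d q f ≤ 1} := by
    refine ⟨⟨∅, by simp, 0, by simp⟩, ?_⟩
    unfold torusLq
    simp [Real.zero_rpow hq0.ne', hq0.ne']
  set m := Nat.log 2 k with hm
  have hm1 : 2 ^ m ≤ k := Nat.pow_log_le_self 2 (by omega)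
  have hm2 : k < 2 ^ (m + 1) := Nat.lt_pow_succ_log_self (by norm_num) k
  have hP := pack_all QF hQ0 V (K * n) (by nlinarith) hVM hV q hq1 hq2 m
  have hP' : PackLE {f : (Fin d → ℝ) → ℝ | IsRealTrigPoly d (hyperbolicCross d γ n) f ∧ torusLq d q f ≤ 1} _ _ :=
    fun S hS hfar => hP S (fun f hf => hA (hS f hf)) hfar
  refine (entNum_le (k := k) hP' (by positivity) (Nat.pow_le_pow_right (by norm_num) hm1) ⟨0, hne⟩).trans ?_
  have hk0 : (0 : ℝ) < k := by exact_mod_cast hk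
  have hre : 2048 * (2 * K) ^ (1 / q) * (n : ℝ) ^ (1 / q) * ((QF.card : ℝ) / k) ^ (1 / q) =
      2048 * (2 * K * (n * (QF.card / k))) ^ (1 / q) := by
    rw [Real.mul_rpow (x := 2 * K) (by positivity) (by positivity),
      Real.mul_rpow (x := (n : ℝ)) (by positivity) (by positivity)]
    ring
  rw [hre]
  gcongr
  have hm2' : (k : ℝ) ≤ 2 * 2 ^ m := by
    have : (k : ℝ) ≤ 2 ^ (m + 1) := by exact_mod_cast hm2.le
    rw [pow_succ] at this; linarith
  calc K * n * QF.card / 2 ^ m = 2 * K * n * QF.card / (2 * 2 ^ m) := by field_simp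
    _ ≤ 2 * K * n * QF.card / k := by gcongr
    _ = 2 * K * (n * (QF.card / k)) := by ring
end
end
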